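/- (Strong converse part of the coding theorem.) Fix 0 < γ < 1, a cost function Γ : 𝒳 → [0,∞) and a budget 𝒫 with 𝒫 ≥ min_{x∈𝒳} Γ(x). For ε ∈ (0,1), let C_ε(γ) denote the supremum of all (ε,γ)-achievable rates, where R ≥ 0 is (ε,γ)-achievable if for every δ > 0 and every sufficiently large n there exists a length-n code of size M whose codewords x_m all satisfy ∑_{a∈𝒳} Γ(a) P̂_{x_m}(a) ≤ 𝒫, such that μ(Λ_ε) ≥ 1 − γ and n⁻¹ log M ≥ R − δ. Then for every ε ∈ (0,1), C_ε(γ) = max over probability mass functions P on 𝒳 with ∑_{a} Γ(a)P(a) ≤ 𝒫 of sup over measurable sets Λ ⊆ Θ with μ(Λ) ≥ 1 − γ of inf_{θ∈Λ} I(P, W(·|·,θ)); in particular C_ε(γ) does not depend on ε. -/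

import Mathlib

open scoped BigOperators
open Finset

section Defs

variable {Θ X Y : Type}

/-- Probability of the output set `B` under the `n`-fold memoryless extension
`Wⁿ(B|x,θ) = ∑_{y∈B} ∏ᵢ W(yᵢ|xᵢ,θ)`. -/
noncomputable def Wn [Fintype Y] (W : Θ → X → Y → ℝ) (n : ℕ) (θ : Θ)
    (x : Fin n → X) (B : Finset (Fin n → Y)) : ℝ :=
  ∑ y ∈ B, ∏ i, W θ (x i) (y i)

/-- Empirical probability mass function `P̂ₓ` of a sequence `x ∈ 𝒳ⁿ`. -/
noncomputable def emp [DecidableEq X] (n : ℕ) (x : Fin n → X) (a : X) : ℝ :=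
  ((Finset.univ.filter fun i => x i = a).card : ℝ) / (n : ℝ)

/-- Empirical conditional pmf `Ŵ_{x,y}` of `y` given `x`. -/
noncomputable def empCond [DecidableEq X] [DecidableEq Y] (n : ℕ)
    (x : Fin n → X) (y : Fin n → Y) (a : X) (b : Y) : ℝ :=
  ((Finset.univ.filter fun i => x i = a ∧ y i = b).card : ℝ) /
    ((Finset.univ.filter fun i => x i = a).card : ℝ)

/-- Kullback–Leibler divergence `D(Q‖P)` (real-valued sum; paired with `absCont`
to encode the `+∞` convention). -/
noncomputable def klDiv [Fintype X] (Q P : X → ℝ) : ℝ :=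
  ∑ a, Q a * Real.log (Q a / P a)

/-- Absolute continuity `Q ≪ P` (finiteness of `D(Q‖P)`). -/
def absCont [Fintype X] (Q P : X → ℝ) : Prop := ∀ a, Q a ≠ 0 → P a ≠ 0

/-- Conditional Kullback–Leibler divergence `D(V‖W|P)` (real-valued sum; paired
with `condAbsCont` to encode the `+∞` convention). -/
noncomputable def condKL [Fintype X] [Fintype Y] (P : X → ℝ) (V W : X → Y → ℝ) : ℝ :=
  ∑ a, P a * ∑ b, V a b * Real.log (V a b / W a b)

/-- Conditional absolute continuity (finiteness of `D(V‖W|P)`). -/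
def condAbsCont (P : X → ℝ) (V W : X → Y → ℝ) : Prop :=
  ∀ a b, P a ≠ 0 → V a b ≠ 0 → W a b ≠ 0

/-- Conditional entropy `H(V|P)`. -/
noncomputable def condEnt [Fintype X] [Fintype Y] (P : X → ℝ) (V : X → Y → ℝ) : ℝ :=
  -∑ a, P a * ∑ b, V a b * Real.log (V a b)

/-- Shannon entropy of a pmf on `Y`. -/
noncomputable def ent [Fintype Y] (Q : Y → ℝ) : ℝ := -∑ b, Q b * Real.log (Q b)

/-- Mutual information `I(P, V)`. -/
noncomputable def mutInfo [Fintype X] [Fintype Y] (P : X → ℝ) (V : X → Y → ℝ) : ℝ :=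
  ∑ a, ∑ b, P a * V a b * Real.log (V a b / ∑ a', P a' * V a' b)

/-- `P` is a probability mass function. -/
def IsPM [Fintype X] (P : X → ℝ) : Prop := (∀ a, 0 ≤ P a) ∧ ∑ a, P a = 1

/-- `V` is a channel from `X` to `Y`. -/
def IsChannel [Fintype Y] (V : X → Y → ℝ) : Prop :=
  (∀ a b, 0 ≤ V a b) ∧ ∀ a, ∑ b, V a b = 1

open scoped Classical in
/-- I-typical input sequences `T_Pⁿ(δ) = {x : D(P̂ₓ‖P) ≤ δ}`. -/
noncomputable def typX [Fintype X] [DecidableEq X] (P : X → ℝ) (n : ℕ) (δ : ℝ) :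
    Finset (Fin n → X) :=
  Finset.univ.filter fun x => absCont (emp n x) P ∧ klDiv (emp n x) P ≤ δ

open scoped Classical in
/-- Conditionally I-typical output sequences `T_Vⁿ(x, δ) = {y : D(Ŵ_{x,y}‖V|P̂ₓ) ≤ δ}`. -/
noncomputable def typY [Fintype X] [Fintype Y] [DecidableEq X] [DecidableEq Y]
    (V : X → Y → ℝ) (n : ℕ) (x : Fin n → X) (δ : ℝ) : Finset (Fin n → Y) :=
  Finset.univ.filter fun y =>
    condAbsCont (emp n x) (empCond n x y) V ∧ condKL (emp n x) (empCond n x y) V ≤ δ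

open scoped Classical in
/-- Robust I-typical set `B_Λⁿ(x, δ) = ⋃_{θ∈Λ} T_{W_θ}ⁿ(x, δ)`. -/
noncomputable def robustTyp [Fintype X] [Fintype Y] [DecidableEq X] [DecidableEq Y]
    (W : Θ → X → Y → ℝ) (n : ℕ) (Λ : Set Θ) (x : Fin n → X) (δ : ℝ) :
    Finset (Fin n → Y) :=
  Finset.univ.filter fun y => ∃ θ ∈ Λ, y ∈ typY (W θ) n x δ

/-- The set `Λ_ε` of channel states at which the maximal error probability of the
code `(c, D)` is at most `ε`. -/
def lambdaSet [Fintype X] [Fintype Y] [DecidableEq X] [DecidableEq Y]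
    (W : Θ → X → Y → ℝ) {n M : ℕ}
    (c : Fin M → Fin n → X) (D : Fin M → Finset (Fin n → Y)) (ε : ℝ) : Set Θ :=
  {θ | ∀ m, Wn W n θ (c m) (D m)ᶜ ≤ ε}

/-- Minimal cardinality `g_Λ(A, η)` of a common `η`-image of `A` via `𝒲_Λ`. -/
noncomputable def gMin [Fintype X] [Fintype Y] (W : Θ → X → Y → ℝ) (n : ℕ)
    (Λ : Set Θ) (A : Finset (Fin n → X)) (η : ℝ) : ℕ :=
  sInf {k : ℕ | ∃ B : Finset (Fin n → Y), B.card = k ∧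
    ∀ x ∈ A, ∀ θ ∈ Λ, η ≤ Wn W n θ x B}

/-- `H(𝒲_Λ|P) = sup_{θ∈Λ} H(W_θ|P)`. -/
noncomputable def entSup [Fintype X] [Fintype Y] (W : Θ → X → Y → ℝ) (Λ : Set Θ)
    (P : X → ℝ) : ℝ :=
  sSup ((fun θ => condEnt P (W θ)) '' Λ)

/-- The set `𝒫_n(𝒴|𝒳)` of empirical conditional pmfs of length-`n` pairs. -/
def empCondSet (X Y : Type) [DecidableEq X] [DecidableEq Y] (n : ℕ) :
    Set (X → Y → ℝ) :=
  {V | ∃ (x : Fin n → X) (y : Fin n → Y), V = fun a b => empCond n x y a b}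

/-- `F` is a relatively τ₀-open subset of `F ∪ Pn`: every `V ∈ F` has a
total-variation neighborhood whose intersection with `Pn` is contained in `F`. -/
def relOpen (F Pn : Set (X → Y → ℝ)) : Prop :=
  ∀ V ∈ F, ∃ r > 0, ∀ V' ∈ Pn, (∀ a b, |V' a b - V a b| < r) → V' ∈ F

/-- A δ-sequence: `δ_n → 0` and `√n · δ_n → ∞`. -/
def IsDeltaSeq (δseq : ℕ → ℝ) : Prop :=
  Filter.Tendsto δseq Filter.atTop (nhds 0) ∧
    Filter.Tendsto (fun n : ℕ => Real.sqrt n * δseq n) Filter.atTop Filter.atTop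

open scoped Classical in
/-- Union over `V ∈ F` of exact conditional type classes `T_Vⁿ(x)`. -/
noncomputable def exactUnion [Fintype X] [Fintype Y] [DecidableEq X] [DecidableEq Y]
    (F : Set (X → Y → ℝ)) (n : ℕ) (x : Fin n → X) : Finset (Fin n → Y) :=
  Finset.univ.filter fun y => ∃ V ∈ F, ∀ a b, empCond n x y a b = V a b

open scoped Classical in
/-- Union over `V ∈ F` of divergence shells `T_Vⁿ(x, ε)`. -/
noncomputable def shellUnion [Fintype X] [Fintype Y] [DecidableEq X] [DecidableEq Y]
    (F : Set (X → Y → ℝ)) (n : ℕ) (x : Fin n → X) (ε : ℝ) : Finset (Fin n → Y) :=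
  Finset.univ.filter fun y => ∃ V ∈ F, y ∈ typY V n x ε

/-- The capacity expression `𝒞(γ, P) = sup_{Λ : μ(Λ) ≥ 1-γ} inf_{θ∈Λ} I(P, W_θ)`. -/
noncomputable def ratesFormula [Fintype X] [Fintype Y] [MeasurableSpace Θ]
    (μ : MeasureTheory.Measure Θ) (W : Θ → X → Y → ℝ) (γ : ℝ) (P : X → ℝ) : ℝ :=
  sSup {r : ℝ | ∃ Λ : Set Θ, MeasurableSet Λ ∧ ENNReal.ofReal (1 - γ) ≤ μ Λ ∧
    r = sInf ((fun θ => mutInfo P (W θ)) '' Λ)}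

/-- A rate `R` is `(ε,γ)`-achievable: for every `δ > 0` and all sufficiently
large `n` there is a length-`n` code of size `M`, with all codewords satisfying
the cost constraint, such that `μ(Λ_ε) ≥ 1-γ` and `n⁻¹ log M ≥ R - δ`. -/
def Achievable [Fintype X] [Fintype Y] [DecidableEq X] [DecidableEq Y] [MeasurableSpace Θ]
    (μ : MeasureTheory.Measure Θ) (W : Θ → X → Y → ℝ) (Γ : X → ℝ)
    (Pbudget γ ε R : ℝ) : Prop :=
  ∀ δ : ℝ, 0 < δ → ∃ N : ℕ, ∀ n : ℕ, N ≤ n →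
    ∃ (M : ℕ) (c : Fin M → Fin n → X) (D : Fin M → Finset (Fin n → Y)),
      0 < M ∧
      (∀ m, ∑ a, Γ a * emp n (c m) a ≤ Pbudget) ∧
      (∀ m m', m ≠ m' → Disjoint (D m) (D m')) ∧
      ENNReal.ofReal (1 - γ) ≤ μ (lambdaSet W c D ε) ∧
      R - δ ≤ (n : ℝ)⁻¹ * Real.log M

end Defs

section FiniteProducts

variable {ι Y : Type} [Fintype ι] [DecidableEq ι] [Fintype Y]

theorem sum_prod_eq_prod_sum (p : ι → Y → ℝ) :
    ∑ y : ι → Y, ∏ i, p i (y i) = ∏ i, ∑ b, p i b := by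
  classical
  rw [Finset.prod_univ_sum, Fintype.piFinset_univ]

theorem sum_prod_mul_sum_sq_of_centered {p f : ι → Y → ℝ} (hp : ∀ i, ∑ b, p i b = 1)
    (hf : ∀ i, ∑ b, p i b * f i b = 0) :
    ∑ y : ι → Y, (∏ i, p i (y i)) * (∑ i, f i (y i)) ^ 2 = ∑ i, ∑ b, p i b * f i b ^ 2 := by
  have expand : ∀ i j : ι, ∑ y : ι → Y, (∏ k, p k (y k)) * (f i (y i) * f j (y j)) =
      ∏ k, ∑ b, p k b * ((if k = i then f k b else 1) * (if k = j then f k b else 1)) := by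
    intro i j
    rw [← sum_prod_eq_prod_sum]
    refine Finset.sum_congr rfl fun y _ => ?_
    simp_rw [Finset.prod_mul_distrib]
    simp
  have diag : ∀ i : ι, ∑ y : ι → Y, (∏ k, p k (y k)) * (f i (y i) * f i (y i)) =
      ∑ b, p i b * f i b ^ 2 := by
    intro i
    rw [expand, Finset.prod_eq_single i]
    · simp [sq]
    · intro k _ hk
      simp [hk, hp]
    · simp
  have off_diag : ∀ i j : ι, j ≠ i →
      ∑ y : ι → Y, (∏ k, p k (y k)) * (f i (y i) * f j (y j)) = 0 := by
    intro i j hij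
    rw [expand]
    refine Finset.prod_eq_zero (Finset.mem_univ i) ?_
    simpa [hij.symm] using hf i
  calc ∑ y : ι → Y, (∏ i, p i (y i)) * (∑ i, f i (y i)) ^ 2
      = ∑ i, ∑ j, ∑ y : ι → Y, (∏ k, p k (y k)) * (f i (y i) * f j (y j)) := by
        simp_rw [sq, Finset.sum_mul_sum, Finset.mul_sum]
        rw [Finset.sum_comm]
        refine Finset.sum_congr rfl fun i _ => ?_
        rw [Finset.sum_comm]
    _ = ∑ i, ∑ b, p i b * f i b ^ 2 := by
        refine Finset.sum_congr rfl fun i _ => ?_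
        rw [Finset.sum_eq_single i (fun j _ hj => off_diag i j hj) (by simp), diag]

/-- Chebyshev's inequality for a sum of independent functions of the coordinates. -/
theorem chebyshev_prod {p : ι → Y → ℝ} (hp0 : ∀ i b, 0 ≤ p i b) (hp : ∀ i, ∑ b, p i b = 1)
    (f : ι → Y → ℝ) {s t : ℝ} (hs : ∑ i, ∑ b, p i b * f i b ^ 2 ≤ s) (ht : 0 < t) :
    ∑ y : ι → Y with t ≤ |∑ i, f i (y i) - ∑ i, ∑ b, p i b * f i b|, ∏ i, p i (y i)
      ≤ s / t ^ 2 := by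
  set m : ι → ℝ := fun i => ∑ b, p i b * f i b with hm
  have variance : ∑ y : ι → Y, (∏ i, p i (y i)) * (∑ i, (f i (y i) - m i)) ^ 2 ≤ s := by
    rw [sum_prod_mul_sum_sq_of_centered (f := fun i b => f i b - m i) hp]
    · refine le_trans (Finset.sum_le_sum fun i _ => ?_) hs
      have : ∑ b, p i b * (f i b - m i) ^ 2 = ∑ b, p i b * f i b ^ 2 - m i ^ 2 := by
        have e : ∀ b, p i b * (f i b - m i) ^ 2 =
            p i b * f i b ^ 2 - 2 * m i * (p i b * f i b) + m i ^ 2 * p i b := fun b => by ring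
        simp_rw [e, Finset.sum_add_distrib, Finset.sum_sub_distrib, ← Finset.mul_sum, hp]
        simp only [hm]
        ring
      rw [this]
      nlinarith [sq_nonneg (m i)]
    · intro i
      simp_rw [mul_sub, Finset.sum_sub_distrib, ← Finset.sum_mul, hp, hm]
      ring
  rw [le_div_iff₀ (by positivity), Finset.sum_mul]
  refine le_trans (Finset.sum_le_sum fun y hy => ?_) (le_trans
    (Finset.sum_le_sum_of_subset_of_nonneg (Finset.subset_univ _) fun y _ _ => ?_) variance)
  · refine mul_le_mul_of_nonneg_left ?_ (Finset.prod_nonneg fun i _ => hp0 i _)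
    rw [Finset.sum_sub_distrib, ← sq_abs (_ - _)]
    exact pow_le_pow_left₀ ht.le (Finset.mem_filter.1 hy).2 2
  · exact mul_nonneg (Finset.prod_nonneg fun i _ => hp0 i _) (sq_nonneg _)

end FiniteProducts

section EmpiricalCounts

theorem sum_filter_exists_le {α β : Type} [Fintype α] [Fintype β] (q : β → α → Prop)
    [∀ b, DecidablePred (q b)] [DecidablePred fun a => ∃ b, q b a] {w : α → ℝ}
    (hw : ∀ a, 0 ≤ w a) :
    ∑ a with ∃ b, q b a, w a ≤ ∑ b, ∑ a with q b a, w a := by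
  simp_rw [Finset.sum_filter]
  rw [Finset.sum_comm]
  refine Finset.sum_le_sum fun a _ => ?_
  have nonneg : ∀ b ∈ Finset.univ, 0 ≤ if q b a then w a else 0 := fun b _ => by
    split_ifs <;> simp [hw]
  split_ifs with h
  · obtain ⟨b, hb⟩ := h
    simpa [hb] using Finset.single_le_sum nonneg (Finset.mem_univ b)
  · exact Finset.sum_nonneg nonneg

theorem sum_comp_eq_sum_card_mul {ι Z : Type} [Fintype ι] [Fintype Z] [DecidableEq Z]
    (z : ι → Z) (g : Z → ℝ) :
    ∑ i, g (z i) = ∑ a, ((Finset.univ.filter fun i => z i = a).card : ℝ) * g a := by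
  rw [← Finset.sum_fiberwise Finset.univ z]
  refine Finset.sum_congr rfl fun a _ => ?_
  rw [Finset.sum_congr rfl (g := fun _ => g a) fun i hi => by rw [(Finset.mem_filter.1 hi).2]]
  simp

variable {X Y : Type} [Fintype X] [DecidableEq X] [Fintype Y] [DecidableEq Y]

theorem sum_comp_eq_emp {n : ℕ} (hn : 0 < n) (x : Fin n → X) (g : X → ℝ) :
    ∑ i, g (x i) = n * ∑ a, emp n x a * g a := by
  have hn' : (n : ℝ) ≠ 0 := by positivity
  rw [sum_comp_eq_sum_card_mul, Finset.mul_sum]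
  refine Finset.sum_congr rfl fun a _ => ?_
  rw [emp]
  field_simp

theorem isPM_emp {n : ℕ} (hn : 0 < n) (x : Fin n → X) : IsPM (emp n x) := by
  refine ⟨fun a => by unfold emp; positivity, ?_⟩
  have h := sum_comp_eq_emp hn x fun _ => 1
  have hn' : (n : ℝ) ≠ 0 := by positivity
  simp only [Finset.sum_const, Finset.card_univ, Fintype.card_fin, nsmul_eq_mul, mul_one] at h
  exact (mul_left_cancel₀ hn' (by rw [← h, mul_one])).symm

omit [Fintype X] in
theorem emp_pos {n : ℕ} (hn : 0 < n) (x : Fin n → X) (i : Fin n) : 0 < emp n x (x i) := by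
  unfold emp
  have : 0 < (Finset.univ.filter fun j => x j = x i).card :=
    Finset.card_pos.2 ⟨i, by simp⟩
  positivity

/-- The empirical distribution concentrates around the averaged law of the coordinates. -/
theorem emp_concentration {n : ℕ} (hn : 0 < n) {p : Fin n → Y → ℝ} (hp0 : ∀ i b, 0 ≤ p i b)
    (hp : ∀ i, ∑ b, p i b = 1) {r : ℝ} (hr : 0 < r) :
    ∑ y : Fin n → Y with ∃ b, r ≤ |emp n y b - (∑ i, p i b) / n|, ∏ i, p i (y i)
      ≤ Fintype.card Y / (n * r ^ 2) := by
  have hn' : (0 : ℝ) < n := by positivity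
  have single : ∀ b, ∑ y : Fin n → Y with r ≤ |emp n y b - (∑ i, p i b) / n|, ∏ i, p i (y i)
      ≤ 1 / (n * r ^ 2) := by
    intro b
    have h := chebyshev_prod hp0 hp (fun _ b' => if b' = b then 1 else 0) (s := n) (t := n * r)
      (by
        refine le_trans (Finset.sum_le_sum fun i _ => (?_ : _ ≤ (1 : ℝ))) (by simp)
        refine le_of_le_of_eq ?_ (hp i)
        exact Finset.sum_le_sum fun b' _ => by by_cases h : b' = b <;> simp [h, hp0])
      (by positivity)
    have e : (n : ℝ) / (n * r) ^ 2 = 1 / (n * r ^ 2) := by field_simp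
    rw [e] at h
    refine le_of_eq_of_le (Finset.sum_congr (Finset.filter_congr fun y _ => ?_) fun _ _ => rfl) h
    have : (∑ i, if y i = b then (1 : ℝ) else 0) - ∑ i, ∑ b', p i b' * (if b' = b then 1 else 0)
        = n * (emp n y b - (∑ i, p i b) / n) := by
      simp [emp, mul_sub, mul_div_cancel₀ _ hn'.ne']
    rw [this, abs_mul, abs_of_pos hn', mul_le_mul_iff_right₀ hn']
  calc _ ≤ ∑ b, ∑ y : Fin n → Y with r ≤ |emp n y b - (∑ i, p i b) / n|, ∏ i, p i (y i) := by
        exact sum_filter_exists_le _ fun y => Finset.prod_nonneg fun i _ => hp0 i _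
    _ ≤ ∑ b : Y, 1 / (n * r ^ 2) := Finset.sum_le_sum fun b _ => single b
    _ = _ := by simp [div_eq_mul_inv]

end EmpiricalCounts

section MutualInformation

theorem mul_log_sq_le {u : ℝ} (h0 : 0 ≤ u) (h1 : u ≤ 1) : u * Real.log u ^ 2 ≤ 4 := by
  rcases h0.eq_or_lt with rfl | hpos
  · simp
  have hs := Real.sqrt_pos.2 hpos
  have h := Real.abs_log_mul_self_lt (√u) hs (Real.sqrt_le_one.2 h1)
  have hl : Real.log u = 2 * Real.log (√u) := by rw [Real.log_sqrt h0]; ring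
  have hu : u = √u ^ 2 := (Real.sq_sqrt h0).symm
  have hsq : (Real.log (√u) * √u) ^ 2 ≤ 1 := (sq_le_one_iff_abs_le_one _).2 h.le
  calc u * Real.log u ^ 2 = √u ^ 2 * Real.log u ^ 2 := by rw [← hu]
    _ = 4 * (Real.log (√u) * √u) ^ 2 := by rw [hl]; ring
    _ ≤ 4 := by linarith

theorem negMulLog_le_one {u : ℝ} (h0 : 0 ≤ u) : Real.negMulLog u ≤ 1 := by
  rcases h0.eq_or_lt with rfl | hpos
  · simp
  have h := Real.one_sub_inv_le_log_of_pos hpos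
  have : u * (1 - u⁻¹) ≤ u * Real.log u := mul_le_mul_of_nonneg_left h h0
  rw [mul_sub, mul_inv_cancel₀ hpos.ne'] at this
  rw [Real.negMulLog]
  linarith

variable {X Y : Type} [Fintype X] [Fintype Y]

theorem IsPM.le_one {P : X → ℝ} (hP : IsPM P) (a : X) : P a ≤ 1 :=
  hP.2 ▸ Finset.single_le_sum (fun a _ => hP.1 a) (Finset.mem_univ a)

omit [Fintype X] in
theorem IsChannel.le_one {V : X → Y → ℝ} (hV : IsChannel V) (a : X) (b : Y) : V a b ≤ 1 :=
  hV.2 a ▸ Finset.single_le_sum (fun b _ => hV.1 a b) (Finset.mem_univ b)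

theorem IsPM.output {P : X → ℝ} {V : X → Y → ℝ} (hP : IsPM P) (hV : IsChannel V) :
    IsPM fun b => ∑ a, P a * V a b := by
  refine ⟨fun b => Finset.sum_nonneg fun a _ => mul_nonneg (hP.1 a) (hV.1 a b), ?_⟩
  rw [Finset.sum_comm]
  simp_rw [← Finset.mul_sum, hV.2, mul_one, hP.2]

theorem output_pos {P : X → ℝ} {V : X → Y → ℝ} (hP : IsPM P) (hV : IsChannel V) {a : X} {b : Y}
    (ha : 0 < P a) (hb : 0 < V a b) : 0 < ∑ a, P a * V a b :=
  lt_of_lt_of_le (mul_pos ha hb)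
    (Finset.single_le_sum (fun a _ => mul_nonneg (hP.1 a) (hV.1 a b)) (Finset.mem_univ a))

/-- Mutual information as output entropy minus conditional entropy. -/
theorem mutInfo_eq {P : X → ℝ} {V : X → Y → ℝ} (hP : IsPM P) (hV : IsChannel V) :
    mutInfo P V = ∑ b, Real.negMulLog (∑ a, P a * V a b) -
      ∑ a, P a * ∑ b, Real.negMulLog (V a b) := by
  have pointwise : ∀ a b, P a * V a b * Real.log (V a b / ∑ a', P a' * V a' b) =
      P a * V a b * Real.log (V a b) - P a * V a b * Real.log (∑ a', P a' * V a' b) := by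
    intro a b
    rcases (hP.1 a).eq_or_lt with ha | ha
    · simp [← ha]
    rcases (hV.1 a b).eq_or_lt with hb | hb
    · simp [← hb]
    rw [Real.log_div hb.ne' (output_pos hP hV ha hb).ne', mul_sub]
  simp_rw [mutInfo, pointwise, Finset.sum_sub_distrib]
  rw [Finset.sum_comm (f := fun a b => P a * V a b * Real.log (∑ a', P a' * V a' b))]
  simp_rw [← Finset.sum_mul, Real.negMulLog, Finset.mul_sum, neg_mul, Finset.sum_neg_distrib,
    mul_neg, Finset.sum_neg_distrib, mul_assoc]
  ring

theorem mutInfo_nonneg {P : X → ℝ} {V : X → Y → ℝ} (hP : IsPM P) (hV : IsChannel V) :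
    0 ≤ mutInfo P V := by
  have pointwise : ∀ a b, P a * V a b - P a * ∑ a', P a' * V a' b ≤
      P a * V a b * Real.log (V a b / ∑ a', P a' * V a' b) := by
    intro a b
    rcases (hP.1 a).eq_or_lt with ha | ha
    · simp [← ha]
    rcases (hV.1 a b).eq_or_lt with hb | hb
    · simpa [← hb] using mul_nonneg ha.le ((hP.output hV).1 b)
    have hQ := output_pos hP hV ha hb
    have h := mul_le_mul_of_nonneg_left (Real.one_sub_inv_le_log_of_pos (div_pos hb hQ))
      (mul_pos ha hb).le
    refine le_trans (le_of_eq ?_) h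
    field_simp
  refine le_trans (le_of_eq ?_)
    (Finset.sum_le_sum fun a _ => Finset.sum_le_sum fun b _ => pointwise a b)
  simp_rw [Finset.sum_sub_distrib, ← Finset.mul_sum, hV.2, (hP.output hV).2]
  ring

theorem mutInfo_le {P : X → ℝ} {V : X → Y → ℝ} (hP : IsPM P) (hV : IsChannel V) :
    mutInfo P V ≤ Fintype.card Y := by
  rw [mutInfo_eq hP hV]
  have h1 : ∑ b, Real.negMulLog (∑ a, P a * V a b) ≤ ∑ _b : Y, (1 : ℝ) :=
    Finset.sum_le_sum fun b _ => negMulLog_le_one ((hP.output hV).1 b)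
  have h2 : 0 ≤ ∑ a, P a * ∑ b, Real.negMulLog (V a b) :=
    Finset.sum_nonneg fun a _ => mul_nonneg (hP.1 a) (Finset.sum_nonneg fun b _ =>
      Real.negMulLog_nonneg (hV.1 a b) (hV.le_one a b))
  simp only [Finset.sum_const, Finset.card_univ, nsmul_eq_mul, mul_one] at h1
  linarith

theorem exists_negMulLog_modulus {δ : ℝ} (hδ : 0 < δ) :
    ∃ r > 0, ∀ u v : ℝ, 0 ≤ u → u ≤ 1 → 0 ≤ v → v ≤ 1 → |u - v| < r →
      |Real.negMulLog u - Real.negMulLog v| < δ := by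
  have h := (isCompact_Icc (a := (0 : ℝ)) (b := 1)).uniformContinuousOn_of_continuous
    Real.continuous_negMulLog.continuousOn
  obtain ⟨r, hr, h⟩ := Metric.uniformContinuousOn_iff.1 h δ hδ
  exact ⟨r, hr, fun u v hu hu' hv hv' huv => h u ⟨hu, hu'⟩ v ⟨hv, hv'⟩ huv⟩

/-- Entropy is uniformly continuous on the probability mass functions. -/
theorem exists_entropy_modulus (Y : Type) [Fintype Y] {δ : ℝ} (hδ : 0 < δ) :
    ∃ r > 0, ∀ Q Q' : Y → ℝ, IsPM Q → IsPM Q' → (∀ b, |Q b - Q' b| < r) →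
      |∑ b, Real.negMulLog (Q b) - ∑ b, Real.negMulLog (Q' b)| ≤ δ := by
  obtain ⟨r, hr, h⟩ := exists_negMulLog_modulus (δ := δ / (Fintype.card Y + 1)) (by positivity)
  refine ⟨r, hr, fun Q Q' hQ hQ' hQQ' => ?_⟩
  rw [← Finset.sum_sub_distrib]
  calc _ ≤ ∑ b, |Real.negMulLog (Q b) - Real.negMulLog (Q' b)| := Finset.abs_sum_le_sum_abs _ _
    _ ≤ ∑ _b : Y, δ / (Fintype.card Y + 1) := Finset.sum_le_sum fun b _ =>
        (h _ _ (hQ.1 b) (hQ.le_one b) (hQ'.1 b) (hQ'.le_one b) (hQQ' b)).le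
    _ = δ * (Fintype.card Y / (Fintype.card Y + 1)) := by simp; ring
    _ ≤ δ * 1 := by
        refine mul_le_mul_of_nonneg_left ?_ hδ.le
        rw [div_le_one (by positivity)]
        linarith
    _ = δ := mul_one δ

/-- Mutual information is continuous in the input law, uniformly over all channels. -/
theorem exists_mutInfo_modulus (X Y : Type) [Fintype X] [Fintype Y] {δ : ℝ} (hδ : 0 < δ) :
    ∃ r > 0, ∀ P P' : X → ℝ, IsPM P → IsPM P' → (∀ a, |P a - P' a| < r) →
      ∀ V : X → Y → ℝ, IsChannel V → mutInfo P V - δ ≤ mutInfo P' V := by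
  obtain ⟨r, hr, h⟩ := exists_entropy_modulus Y (half_pos hδ)
  set x : ℝ := ((Fintype.card X : ℕ) : ℝ)
  set y : ℝ := ((Fintype.card Y : ℕ) : ℝ)
  have hx : 0 ≤ x := by positivity
  have hy : 0 ≤ y := by positivity
  refine ⟨min (r / (x + 1)) (δ / 2 / ((x + 1) * (y + 1))), by positivity,
    fun P P' hP hP' hPP' V hV => ?_⟩
  have close : ∀ a, |P a - P' a| < r / (x + 1) := fun a => (hPP' a).trans_le (min_le_left _ _)
  have close' : ∀ a, |P a - P' a| < δ / 2 / ((x + 1) * (y + 1)) := fun a =>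
    (hPP' a).trans_le (min_le_right _ _)
  have outputs := h _ _ (hP.output hV) (hP'.output hV) fun b => by
    rw [← Finset.sum_sub_distrib]
    calc _ ≤ ∑ a, |P a * V a b - P' a * V a b| := Finset.abs_sum_le_sum_abs _ _
      _ ≤ ∑ _a : X, r / (x + 1) := Finset.sum_le_sum fun a _ => by
          rw [← sub_mul, abs_mul, abs_of_nonneg (hV.1 a b)]
          exact (mul_le_of_le_one_right (abs_nonneg _) (hV.le_one a b)).trans (close a).le
      _ = x * r / (x + 1) := by simp [x]; ring
      _ < r := by rw [div_lt_iff₀ (by positivity)]; nlinarith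
  have conds : |∑ a, P a * ∑ b, Real.negMulLog (V a b) - ∑ a, P' a * ∑ b, Real.negMulLog (V a b)|
      ≤ δ / 2 := by
    rw [← Finset.sum_sub_distrib]
    calc _ ≤ ∑ a, |P a * ∑ b, Real.negMulLog (V a b) - P' a * ∑ b, Real.negMulLog (V a b)| :=
          Finset.abs_sum_le_sum_abs _ _
      _ ≤ ∑ _a : X, δ / 2 / ((x + 1) * (y + 1)) * y := Finset.sum_le_sum fun a _ => by
          have h0 : 0 ≤ ∑ b, Real.negMulLog (V a b) := Finset.sum_nonneg fun b _ =>
            Real.negMulLog_nonneg (hV.1 a b) (hV.le_one a b)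
          have h1 : ∑ b, Real.negMulLog (V a b) ≤ y := by
            refine (Finset.sum_le_sum fun b _ => negMulLog_le_one (hV.1 a b)).trans ?_
            simp [y]
          rw [← sub_mul, abs_mul, abs_of_nonneg h0]
          exact mul_le_mul (close' a).le h1 h0 (by positivity)
      _ = δ / 2 * (x / (x + 1) * (y / (y + 1))) := by
          simp only [Finset.sum_const, Finset.card_univ, nsmul_eq_mul]
          field_simp
          simp [x]
      _ ≤ δ / 2 * (1 * 1) := by
          have h1 : x / (x + 1) ≤ 1 := by rw [div_le_one (by positivity)]; linarith
          have h2 : y / (y + 1) ≤ 1 := by rw [div_le_one (by positivity)]; linarith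
          gcongr
      _ = δ / 2 := by ring
  rw [mutInfo_eq hP hV, mutInfo_eq hP' hV]
  rw [abs_le] at outputs conds
  linarith [outputs.1, outputs.2, conds.1, conds.2]

end MutualInformation

section Asymptotics

theorem exists_mul_pow_le_exp (C : ℝ) (d : ℕ) {δ : ℝ} (hδ : 0 < δ) :
    ∃ N : ℕ, ∀ n : ℕ, N ≤ n → C * ((n : ℝ) + 1) ^ d ≤ Real.exp (n * δ) := by
  have h := (isLittleO_pow_exp_pos_mul_atTop d hδ).comp_tendsto
    ((Filter.tendsto_atTop_add_const_right _ (1 : ℝ) tendsto_natCast_atTop_atTop))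
  obtain ⟨N, hN⟩ := Filter.eventually_atTop.1
    (h.bound (c := Real.exp (-δ) / (|C| + 1)) (by positivity))
  refine ⟨N, fun n hn => ?_⟩
  have hb := hN n hn
  simp only [Function.comp_apply, Real.norm_eq_abs, Real.abs_exp] at hb
  rw [abs_of_nonneg (by positivity), div_mul_eq_mul_div, le_div_iff₀ (by positivity),
    ← Real.exp_add] at hb
  have e : -δ + δ * ((n : ℝ) + 1) = n * δ := by ring
  rw [e] at hb
  refine le_trans ?_ hb
  rw [mul_comm]
  exact mul_le_mul_of_nonneg_left (by linarith [le_abs_self C]) (by positivity)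

theorem exists_div_le (C : ℝ) {η : ℝ} (hη : 0 < η) :
    ∃ N : ℕ, 0 < N ∧ ∀ n : ℕ, N ≤ n → C / n ≤ η := by
  obtain ⟨N, hN⟩ := Filter.eventually_atTop.1
    ((tendsto_const_div_atTop_nhds_zero_nat C).eventually (eventually_le_nhds hη))
  exact ⟨N + 1, N.succ_pos, fun n hn => hN n (by omega)⟩

end Asymptotics

section Converse

variable {X Y : Type} [Fintype X] [DecidableEq X] [Fintype Y]

omit [Fintype X] [DecidableEq X] in
theorem IsChannel.sum_prod {V : X → Y → ℝ} (hV : IsChannel V) {n : ℕ} (x : Fin n → X) :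
    ∑ y : Fin n → Y, ∏ i, V (x i) (y i) = 1 := by
  rw [sum_prod_eq_prod_sum fun i b => V (x i) b]
  simp [hV.2]

omit [Fintype X] [DecidableEq X] in
theorem IsChannel.one_sub_le_sum [DecidableEq Y] {V : X → Y → ℝ} (hV : IsChannel V) {n : ℕ}
    {x : Fin n → X} {D : Finset (Fin n → Y)} {ε : ℝ}
    (hD : ∑ y ∈ Dᶜ, ∏ i, V (x i) (y i) ≤ ε) : 1 - ε ≤ ∑ y ∈ D, ∏ i, V (x i) (y i) := by
  have h := Finset.sum_add_sum_compl D fun y => ∏ i, V (x i) (y i)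
  rw [hV.sum_prod] at h
  linarith

/-- The second moment of the information density is bounded uniformly over all channels. -/
theorem info_density_second_moment {V : X → Y → ℝ} (hV : IsChannel V) {n : ℕ} (hn : 0 < n)
    (x : Fin n → X) :
    ∑ i, ∑ b, V (x i) b * Real.log (V (x i) b / ∑ a, emp n x a * V a b) ^ 2
      ≤ 16 * Fintype.card Y * n := by
  have hP := isPM_emp hn x
  have hQ := hP.output hV
  have pointwise : ∀ i b, V (x i) b * Real.log (V (x i) b / ∑ a, emp n x a * V a b) ^ 2 ≤
      8 + 2 * (V (x i) b * Real.log (∑ a, emp n x a * V a b) ^ 2) := by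
    intro i b
    rcases (hV.1 (x i) b).eq_or_lt with hb | hb
    · simp [← hb]
    rw [Real.log_div hb.ne' (output_pos hP hV (emp_pos hn x i) hb).ne']
    have h := mul_log_sq_le hb.le (hV.le_one _ _)
    nlinarith [mul_nonneg hb.le
      (sq_nonneg (Real.log (V (x i) b) + Real.log (∑ a, emp n x a * V a b)))]
  have outputs : ∑ i, ∑ b, V (x i) b * Real.log (∑ a, emp n x a * V a b) ^ 2 ≤
      n * (4 * Fintype.card Y) := by
    rw [sum_comp_eq_emp hn x fun a => ∑ b, V a b * Real.log (∑ a, emp n x a * V a b) ^ 2]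
    refine mul_le_mul_of_nonneg_left ?_ (Nat.cast_nonneg n)
    simp_rw [Finset.mul_sum, ← mul_assoc]
    rw [Finset.sum_comm]
    simp_rw [← Finset.sum_mul]
    refine (Finset.sum_le_sum fun b _ => mul_log_sq_le (hQ.1 b) (hQ.le_one b)).trans ?_
    simp [mul_comm]
  refine (Finset.sum_le_sum fun i _ => Finset.sum_le_sum fun b _ => pointwise i b).trans ?_
  simp_rw [Finset.sum_add_distrib, ← Finset.mul_sum]
  simp only [Finset.sum_const, Finset.card_univ, nsmul_eq_mul, Fintype.card_fin]
  linarith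

/-- A set that is likely under the channel cannot have too small output probability. -/
theorem one_sub_le_exp_mul_output [DecidableEq Y] {V : X → Y → ℝ} (hV : IsChannel V) {n : ℕ}
    (hn : 0 < n) {x : Fin n → X} {D : Finset (Fin n → Y)} {ε δ : ℝ} (hδ : 0 < δ)
    (hD : ∑ y ∈ Dᶜ, ∏ i, V (x i) (y i) ≤ ε) :
    1 - ε - 16 * Fintype.card Y / δ ^ 2 / n ≤
      Real.exp (n * (mutInfo (emp n x) V + δ)) *
        ∑ y ∈ D, ∏ i, ∑ a, emp n x a * V a (y i) := by
  have hn' : (0 : ℝ) < n := by positivity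
  have hP := isPM_emp hn x
  have hQ := hP.output hV
  have cheb := chebyshev_prod (fun i b => hV.1 (x i) b) (fun i => hV.2 (x i))
    (fun i b => Real.log (V (x i) b / ∑ a, emp n x a * V a b))
    (info_density_second_moment hV hn x) (t := n * δ) (by positivity)
  have mean : ∑ i, ∑ b, V (x i) b * Real.log (V (x i) b / ∑ a, emp n x a * V a b) =
      n * mutInfo (emp n x) V := by
    rw [sum_comp_eq_emp hn x fun a => ∑ b, V a b * Real.log (V a b / ∑ a, emp n x a * V a b)]
    simp_rw [mutInfo, Finset.mul_sum, mul_assoc]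
  rw [mean] at cheb
  set bad : Finset (Fin n → Y) := Finset.univ.filter fun y =>
    n * δ ≤ |∑ i, Real.log (V (x i) (y i) / ∑ a, emp n x a * V a (y i)) -
      n * mutInfo (emp n x) V|
  have good : ∀ y ∉ bad, ∏ i, V (x i) (y i) ≤
      Real.exp (n * (mutInfo (emp n x) V + δ)) * ∏ i, ∑ a, emp n x a * V a (y i) := by
    intro y hy
    by_cases h0 : ∃ i, V (x i) (y i) = 0
    · obtain ⟨i, hi⟩ := h0
      rw [Finset.prod_eq_zero (Finset.mem_univ i) hi]
      exact mul_nonneg (Real.exp_pos _).le (Finset.prod_nonneg fun i _ => hQ.1 _)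
    push Not at h0
    have hVpos : ∀ i, 0 < V (x i) (y i) := fun i => (hV.1 _ _).lt_of_ne (h0 i).symm
    have hQpos : ∀ i, 0 < ∑ a, emp n x a * V a (y i) := fun i =>
      output_pos hP hV (emp_pos hn x i) (hVpos i)
    have hsum : ∑ i, Real.log (V (x i) (y i) / ∑ a, emp n x a * V a (y i)) ≤
        n * (mutInfo (emp n x) V + δ) := by
      have := (le_abs_self _).trans (not_le.1 fun h => hy (by simpa [bad] using h)).le
      linarith
    rw [← div_le_iff₀ (Finset.prod_pos fun i _ => hQpos i), ← Finset.prod_div_distrib]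
    refine le_trans (le_of_eq ?_) (Real.exp_le_exp.2 hsum)
    rw [Real.exp_sum]
    exact Finset.prod_congr rfl fun i _ => (Real.exp_log (div_pos (hVpos i) (hQpos i))).symm
  have split : ∑ y ∈ D, ∏ i, V (x i) (y i) ≤ ∑ y ∈ bad, ∏ i, V (x i) (y i) +
      ∑ y ∈ D, Real.exp (n * (mutInfo (emp n x) V + δ)) * ∏ i, ∑ a, emp n x a * V a (y i) := by
    rw [← Finset.sum_inter_add_sum_sdiff D bad]
    refine add_le_add (Finset.sum_le_sum_of_subset_of_nonneg Finset.inter_subset_right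
      fun y _ _ => Finset.prod_nonneg fun i _ => hV.1 _ _) ?_
    refine (Finset.sum_le_sum fun y hy => good y (Finset.mem_sdiff.1 hy).2).trans
      (Finset.sum_le_sum_of_subset_of_nonneg Finset.sdiff_subset fun y _ _ => ?_)
    exact mul_nonneg (Real.exp_pos _).le (Finset.prod_nonneg fun i _ => hQ.1 _)
  rw [← Finset.mul_sum] at split
  have e : 16 * (Fintype.card Y : ℝ) * n / (n * δ) ^ 2 = 16 * Fintype.card Y / δ ^ 2 / n := by
    field_simp
  rw [e] at cheb
  linarith [hV.one_sub_le_sum hD]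

/-- Size bound for constant-composition codes. -/
theorem card_mul_le_exp_of_constant_composition [DecidableEq Y] {V : X → Y → ℝ}
    (hV : IsChannel V) {n : ℕ} (hn : 0 < n) {M : ℕ} {c : Fin M → Fin n → X}
    {D : Fin M → Finset (Fin n → Y)} (hdisj : ∀ m m', m ≠ m' → Disjoint (D m) (D m'))
    {ε δ : ℝ} (hδ : 0 < δ) (hD : ∀ m, ∑ y ∈ (D m)ᶜ, ∏ i, V (c m i) (y i) ≤ ε)
    {P : X → ℝ} (hP : IsPM P) {S : Finset (Fin M)} (hS : ∀ m ∈ S, emp n (c m) = P) :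
    (S.card : ℝ) * (1 - ε - 16 * Fintype.card Y / δ ^ 2 / n) ≤
      Real.exp (n * (mutInfo P V + δ)) := by
  have hQ := hP.output hV
  calc (S.card : ℝ) * (1 - ε - 16 * Fintype.card Y / δ ^ 2 / n)
      = ∑ _m ∈ S, (1 - ε - 16 * Fintype.card Y / δ ^ 2 / n) := by
        rw [Finset.sum_const, nsmul_eq_mul]
    _ ≤ ∑ m ∈ S, Real.exp (n * (mutInfo P V + δ)) *
          ∑ y ∈ D m, ∏ i, ∑ a, P a * V a (y i) := Finset.sum_le_sum fun m hm => by
        have := one_sub_le_exp_mul_output hV hn hδ (hD m)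
        rwa [hS m hm] at this
    _ = Real.exp (n * (mutInfo P V + δ)) *
          ∑ y ∈ S.biUnion D, ∏ i, ∑ a, P a * V a (y i) := by
        rw [← Finset.mul_sum, Finset.sum_biUnion fun m _ m' _ h => hdisj m m' h]
    _ ≤ Real.exp (n * (mutInfo P V + δ)) * 1 := by
        refine mul_le_mul_of_nonneg_left ?_ (Real.exp_pos _).le
        refine (Finset.sum_le_sum_of_subset_of_nonneg (Finset.subset_univ _) fun y _ _ =>
          Finset.prod_nonneg fun i _ => hQ.1 _).trans (le_of_eq ?_)
        rw [sum_prod_eq_prod_sum fun _ b => ∑ a, P a * V a b]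
        simp [hQ.2]
    _ = _ := mul_one _

theorem card_image_le_of_factors {α β κ : Type} [Fintype α] [DecidableEq β] [Fintype κ]
    (f : α → β) (k : α → κ) (g : κ → β) (h : ∀ a, f a = g (k a)) :
    (Finset.univ.image f).card ≤ Fintype.card κ := by
  refine (Finset.card_le_card (t := Finset.univ.image g) ?_).trans Finset.card_image_le
  intro b hb
  obtain ⟨a, -, rfl⟩ := Finset.mem_image.1 hb
  exact Finset.mem_image.2 ⟨k a, Finset.mem_univ _, (h a).symm⟩

theorem card_filter_lt_succ {n : ℕ} (q : Fin n → Prop) [DecidablePred q] :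
    (Finset.univ.filter q).card < n + 1 :=
  Nat.lt_succ_of_le ((Finset.card_le_univ _).trans (by simp))

open scoped Classical in
theorem card_image_emp_le (X : Type) [Fintype X] [DecidableEq X] (n : ℕ) :
    (Finset.univ.image fun x : Fin n → X => emp n x).card ≤ (n + 1) ^ Fintype.card X := by
  let k : (Fin n → X) → X → Fin (n + 1) := fun x a =>
    ⟨_, card_filter_lt_succ fun i => x i = a⟩
  let g : (X → Fin (n + 1)) → X → ℝ := fun k a => ((k a : ℕ) : ℝ) / n
  have h := card_image_le_of_factors (fun x : Fin n → X => emp n x) k g fun x => rfl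
  rwa [Fintype.card_fun, Fintype.card_fin] at h

/-- Strong converse: up to `δ`, the rate of any code is at most the mutual information of some
codeword type, simultaneously for all channels on which the code has error at most `ε`. -/
theorem exists_codeword_rate_le (X Y : Type) [Fintype X] [DecidableEq X] [Fintype Y]
    [DecidableEq Y] {ε δ : ℝ} (hε : ε < 1) (hδ : 0 < δ) :
    ∃ N : ℕ, 0 < N ∧ ∀ n : ℕ, N ≤ n → ∀ (M : ℕ) (c : Fin M → Fin n → X)
      (D : Fin M → Finset (Fin n → Y)), 0 < M →
      (∀ m m', m ≠ m' → Disjoint (D m) (D m')) →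
      ∃ m₀, ∀ V : X → Y → ℝ, IsChannel V →
        (∀ m, ∑ y ∈ (D m)ᶜ, ∏ i, V (c m i) (y i) ≤ ε) →
        (n : ℝ)⁻¹ * Real.log M ≤ mutInfo (emp n (c m₀)) V + δ := by
  classical
  obtain ⟨N₁, hN₁, h₁⟩ := exists_div_le (16 * Fintype.card Y / (δ / 2) ^ 2)
    (show 0 < (1 - ε) / 2 by linarith)
  obtain ⟨N₂, h₂⟩ := exists_mul_pow_le_exp (2 / (1 - ε)) (Fintype.card X) (half_pos hδ)
  refine ⟨max N₁ N₂, lt_max_of_lt_left hN₁, fun n hn M c D hM hdisj => ?_⟩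
  have hn0 : 0 < n := hN₁.trans_le ((le_max_left _ _).trans hn)
  have hn' : (0 : ℝ) < n := by positivity
  have hε' : 0 < 1 - ε := by linarith
  have : Nonempty (Fin M) := ⟨⟨0, hM⟩⟩
  let fiber : Fin M → Finset (Fin M) := fun m =>
    Finset.univ.filter fun m' => emp n (c m') = emp n (c m)
  obtain ⟨m₀, hm₀⟩ := Finite.exists_max fun m => (fiber m).card
  refine ⟨m₀, fun V hV hD => ?_⟩
  have hcard : (M : ℝ) ≤ (fiber m₀).card * ((n : ℝ) + 1) ^ Fintype.card X := by
    have h := Finset.card_le_mul_card_image (f := fun m => emp n (c m)) Finset.univ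
      (fiber m₀).card fun P hP => by
        obtain ⟨m, -, rfl⟩ := Finset.mem_image.1 hP
        exact hm₀ m
    rw [Finset.card_univ, Fintype.card_fin] at h
    have h' : (Finset.univ.image fun m => emp n (c m)).card ≤ (n + 1) ^ Fintype.card X := by
      refine (Finset.card_le_card fun P hP => ?_).trans (card_image_emp_le X n)
      obtain ⟨m, -, rfl⟩ := Finset.mem_image.1 hP
      exact Finset.mem_image_of_mem _ (Finset.mem_univ _)
    exact_mod_cast h.trans (Nat.mul_le_mul_left _ h')
  have hsize := card_mul_le_exp_of_constant_composition hV hn0 hdisj (half_pos hδ) hD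
    (isPM_emp hn0 (c m₀)) (S := fiber m₀) fun m hm => (Finset.mem_filter.1 hm).2
  have hsmall := h₁ n ((le_max_left _ _).trans hn)
  have hpoly := h₂ n ((le_max_right _ _).trans hn)
  have hfiber : ((fiber m₀).card : ℝ) ≤
      2 / (1 - ε) * Real.exp (n * (mutInfo (emp n (c m₀)) V + δ / 2)) := by
    rw [div_mul_eq_mul_div, le_div_iff₀ hε']
    nlinarith [mul_le_mul_of_nonneg_left hsmall (Nat.cast_nonneg (α := ℝ) (fiber m₀).card)]
  have hM' : (M : ℝ) ≤ Real.exp (n * (mutInfo (emp n (c m₀)) V + δ)) := by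
    calc (M : ℝ) ≤ (2 / (1 - ε) * Real.exp (n * (mutInfo (emp n (c m₀)) V + δ / 2))) *
          ((n : ℝ) + 1) ^ Fintype.card X := hcard.trans (by gcongr)
      _ = (2 / (1 - ε) * ((n : ℝ) + 1) ^ Fintype.card X) *
          Real.exp (n * (mutInfo (emp n (c m₀)) V + δ / 2)) := by ring
      _ ≤ Real.exp (n * (δ / 2)) *
          Real.exp (n * (mutInfo (emp n (c m₀)) V + δ / 2)) := by gcongr
      _ = _ := by rw [← Real.exp_add]; ring_nf
  rw [inv_mul_le_iff₀ hn']
  exact (Real.log_le_iff_le_exp (by positivity)).2 hM'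

end Converse

section MaximumLikelihood

/-- A substochastic matrix: nonnegative entries and row sums at most one. -/
def IsSubchannel {X Y : Type} [Fintype Y] (V : X → Y → ℝ) : Prop :=
  (∀ a b, 0 ≤ V a b) ∧ ∀ a, ∑ b, V a b ≤ 1

/-- The likelihood of `y` given `x` under the best memoryless channel. -/
noncomputable def condMaxLik {X Y : Type} [DecidableEq X] [DecidableEq Y] {n : ℕ}
    (x : Fin n → X) (y : Fin n → Y) : ℝ :=
  ∏ i, empCond n x y (x i) (y i)

/-- The likelihood of `y` under the best memoryless source. -/
noncomputable def maxLik {Y : Type} [DecidableEq Y] {n : ℕ} (y : Fin n → Y) : ℝ :=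
  ∏ i, emp n y (y i)

variable {X Y : Type} [Fintype X] [DecidableEq X] [Fintype Y] [DecidableEq Y]

omit [Fintype X] [DecidableEq X] [DecidableEq Y] in
theorem IsChannel.isSubchannel {V : X → Y → ℝ} (hV : IsChannel V) : IsSubchannel V :=
  ⟨hV.1, fun a => (hV.2 a).le⟩

omit [Fintype X] in
theorem sum_card_filter_and {n : ℕ} (x : Fin n → X) (y : Fin n → Y) (a : X) :
    ∑ b, (Finset.univ.filter fun i => x i = a ∧ y i = b).card =
      (Finset.univ.filter fun i => x i = a).card := by
  rw [Finset.card_eq_sum_card_fiberwise (f := y) (t := Finset.univ) (by simp)]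
  simp_rw [Finset.filter_filter]

omit [Fintype X] in
theorem isSubchannel_empCond {n : ℕ} (x : Fin n → X) (y : Fin n → Y) :
    IsSubchannel (empCond n x y) := by
  refine ⟨fun a b => by unfold empCond; positivity, fun a => ?_⟩
  simp_rw [empCond, ← Finset.sum_div]
  rw [← Nat.cast_sum, sum_card_filter_and]
  exact div_self_le_one _

/-- Empirical conditional laws maximize the likelihood. -/
theorem prod_le_condMaxLik {V : X → Y → ℝ} (hV : IsSubchannel V) {n : ℕ}
    (x : Fin n → X) (y : Fin n → Y) : ∏ i, V (x i) (y i) ≤ condMaxLik x y := by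
  have hpos : ∀ i, 0 < empCond n x y (x i) (y i) := fun i => by
    have h₁ : 0 < (Finset.univ.filter fun j => x j = x i ∧ y j = y i).card :=
      Finset.card_pos.2 ⟨i, by simp⟩
    have h₂ : 0 < (Finset.univ.filter fun j => x j = x i).card :=
      Finset.card_pos.2 ⟨i, by simp⟩
    unfold empCond
    positivity
  have cell : ∀ a b, ((Finset.univ.filter fun i => (x i, y i) = (a, b)).card : ℝ) *
      (V a b / empCond n x y a b) ≤ (Finset.univ.filter fun i => x i = a).card * V a b := by
    intro a b
    simp_rw [empCond, Prod.mk.injEq]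
    rcases (Nat.cast_nonneg (α := ℝ)
      (Finset.univ.filter fun i => x i = a ∧ y i = b).card).eq_or_lt with h | h
    · rw [← h]
      simpa using mul_nonneg (Nat.cast_nonneg _) (hV.1 _ _)
    · refine le_of_eq ?_
      field_simp
  have total : ∑ i, V (x i) (y i) / empCond n x y (x i) (y i) ≤ n := by
    rw [sum_comp_eq_sum_card_mul (fun i => (x i, y i))
      fun z => V z.1 z.2 / empCond n x y z.1 z.2, Fintype.sum_prod_type]
    refine (Finset.sum_le_sum fun a _ => Finset.sum_le_sum fun b _ => cell a b).trans ?_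
    simp_rw [← Finset.mul_sum]
    calc _ ≤ ∑ a, ((Finset.univ.filter fun i => x i = a).card : ℝ) * 1 :=
          Finset.sum_le_sum fun a _ => mul_le_mul_of_nonneg_left (hV.2 a) (Nat.cast_nonneg _)
      _ = n := by rw [← sum_comp_eq_sum_card_mul x fun _ => 1]; simp
  have ratio : ∏ i, V (x i) (y i) / empCond n x y (x i) (y i) ≤ 1 := by
    calc _ ≤ ∏ i, Real.exp (V (x i) (y i) / empCond n x y (x i) (y i) - 1) :=
          Finset.prod_le_prod (fun i _ => div_nonneg (hV.1 _ _) (hpos i).le) fun i _ => by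
            simpa using Real.add_one_le_exp (V (x i) (y i) / empCond n x y (x i) (y i) - 1)
      _ ≤ 1 := by
          rw [← Real.exp_sum, Finset.sum_sub_distrib]
          refine Real.exp_le_one_iff.2 ?_
          simpa using total
  rwa [Finset.prod_div_distrib, div_le_one (Finset.prod_pos fun i _ => hpos i)] at ratio

theorem prod_le_maxLik {Q : Y → ℝ} (hQ0 : ∀ b, 0 ≤ Q b) (hQ : ∑ b, Q b ≤ 1) {n : ℕ}
    (y : Fin n → Y) : ∏ i, Q (y i) ≤ maxLik y := by
  have h := prod_le_condMaxLik (V := fun _ : Unit => Q) ⟨fun _ => hQ0, fun _ => hQ⟩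
    (fun _ => ()) y
  simpa [condMaxLik, empCond, maxLik, emp] using h

omit [Fintype Y] in
theorem maxLik_nonneg {n : ℕ} (y : Fin n → Y) : 0 ≤ maxLik y :=
  Finset.prod_nonneg fun i _ => by unfold emp; positivity

open scoped Classical in
/-- The finite family of all empirical conditional laws of block length `n`. -/
noncomputable def empChannels (X Y : Type) [Fintype X] [DecidableEq X] [Fintype Y]
    [DecidableEq Y] (n : ℕ) : Finset (X → Y → ℝ) :=
  Finset.univ.image fun xy : (Fin n → X) × (Fin n → Y) => empCond n xy.1 xy.2

theorem card_empChannels_le (X Y : Type) [Fintype X] [DecidableEq X] [Fintype Y]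
    [DecidableEq Y] (n : ℕ) :
    (empChannels X Y n).card ≤ (n + 1) ^ (Fintype.card X * Fintype.card Y) := by
  classical
  let k : (Fin n → X) × (Fin n → Y) → X × Y → Fin (n + 1) := fun xy z =>
    ⟨_, card_filter_lt_succ fun i => xy.1 i = z.1 ∧ xy.2 i = z.2⟩
  let g : (X × Y → Fin (n + 1)) → X → Y → ℝ := fun k a b =>
    ((k (a, b) : ℕ) : ℝ) / (∑ b', (k (a, b') : ℕ) : ℕ)
  have h := card_image_le_of_factors
    (fun xy : (Fin n → X) × (Fin n → Y) => empCond n xy.1 xy.2) k g fun xy => by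
      funext a b
      simp only [g, k, sum_card_filter_and, empCond]
  rwa [Fintype.card_fun, Fintype.card_fin, Fintype.card_prod] at h

theorem isSubchannel_of_mem_empChannels {n : ℕ} {V : X → Y → ℝ} (hV : V ∈ empChannels X Y n) :
    IsSubchannel V := by
  obtain ⟨xy, -, rfl⟩ := Finset.mem_image.1 hV
  exact isSubchannel_empCond _ _

theorem condMaxLik_le_sum {n : ℕ} (x : Fin n → X) (y : Fin n → Y) :
    condMaxLik x y ≤ ∑ V ∈ empChannels X Y n, ∏ i, V (x i) (y i) :=
  Finset.single_le_sum (f := fun V : X → Y → ℝ => ∏ i, V (x i) (y i))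
    (fun _ hV => Finset.prod_nonneg fun _ _ => (isSubchannel_of_mem_empChannels hV).1 _ _)
    (Finset.mem_image.2 ⟨(x, y), Finset.mem_univ _, rfl⟩)

theorem sum_condMaxLik_le {n : ℕ} (x : Fin n → X) :
    ∑ y : Fin n → Y, condMaxLik x y ≤ (empChannels X Y n).card := by
  refine (Finset.sum_le_sum fun y _ => condMaxLik_le_sum x y).trans ?_
  rw [Finset.sum_comm, Finset.card_eq_sum_ones, Nat.cast_sum]
  refine Finset.sum_le_sum fun V hV => ?_
  have h := isSubchannel_of_mem_empChannels hV
  rw [sum_prod_eq_prod_sum fun i b => V (x i) b, Nat.cast_one]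
  exact Finset.prod_le_one (fun i _ => Finset.sum_nonneg fun b _ => h.1 _ _) fun i _ => h.2 _

theorem sum_mul_condMaxLik_le {P : X → ℝ} (hP : IsPM P) {n : ℕ} (y : Fin n → Y) :
    ∑ x : Fin n → X, (∏ i, P (x i)) * condMaxLik x y ≤
      (empChannels X Y n).card * maxLik y := by
  have hP' : ∀ x : Fin n → X, 0 ≤ ∏ i, P (x i) := fun x => Finset.prod_nonneg fun i _ => hP.1 _
  refine (Finset.sum_le_sum fun x _ =>
    mul_le_mul_of_nonneg_left (condMaxLik_le_sum x y) (hP' x)).trans ?_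
  simp_rw [Finset.mul_sum]
  rw [Finset.sum_comm, ← nsmul_eq_mul]
  refine Finset.sum_le_card_nsmul _ _ _ fun V hV => ?_
  have h := isSubchannel_of_mem_empChannels hV
  simp_rw [← Finset.prod_mul_distrib]
  rw [sum_prod_eq_prod_sum fun i a => P a * V a (y i)]
  refine prod_le_maxLik (Q := fun b => ∑ a, P a * V a b)
    (fun b => Finset.sum_nonneg fun a _ => mul_nonneg (hP.1 a) (h.1 a b)) ?_ y
  rw [Finset.sum_comm]
  simp_rw [← Finset.mul_sum]
  exact (Finset.sum_le_sum fun a _ => mul_le_of_le_one_right (hP.1 a) (h.2 a)).trans hP.2.le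

end MaximumLikelihood

section Decoding

variable {X Y : Type} [Fintype X] [DecidableEq X] [Fintype Y] [DecidableEq Y]

open scoped Classical in
/-- Outputs whose universal likelihood ratio with respect to `x` is at least `exp T`. -/
noncomputable def decodingRegion {n : ℕ} (T : ℝ) (x : Fin n → X) : Finset (Fin n → Y) :=
  Finset.univ.filter fun y => Real.exp T * maxLik y ≤ condMaxLik x y

theorem sum_decodingRegion_maxLik_le {n : ℕ} (T : ℝ) (x : Fin n → X) :
    ∑ y ∈ decodingRegion (Y := Y) T x, maxLik y ≤
      Real.exp (-T) * (empChannels X Y n).card := by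
  calc ∑ y ∈ decodingRegion (Y := Y) T x, maxLik y
      ≤ ∑ y ∈ decodingRegion (Y := Y) T x, Real.exp (-T) * condMaxLik x y :=
        Finset.sum_le_sum fun y hy => by
          have h := (Finset.mem_filter.1 hy).2
          rw [Real.exp_neg, ← div_eq_inv_mul, le_div_iff₀' (Real.exp_pos T)]
          exact h
    _ ≤ ∑ y, Real.exp (-T) * condMaxLik x y :=
        Finset.sum_le_sum_of_subset_of_nonneg (Finset.subset_univ _) fun y _ _ =>
          mul_nonneg (Real.exp_pos _).le
            (Finset.prod_nonneg fun i _ => (isSubchannel_empCond x y).1 _ _)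
    _ ≤ _ := by
        rw [← Finset.mul_sum]
        exact mul_le_mul_of_nonneg_left (sum_condMaxLik_le x) (Real.exp_pos _).le

/-- Greedy construction of a code with maximal error at most `ε` on every channel of `𝒲`. -/
theorem exists_code_of_card_lt {𝒲 : Set (X → Y → ℝ)} (h𝒲 : ∀ V ∈ 𝒲, IsChannel V) {n : ℕ}
    {P : X → ℝ} (hP : IsPM P) {F : Finset (Fin n → X)} (hF : 1 / 2 ≤ ∑ x ∈ F, ∏ i, P (x i))
    {ε T : ℝ} (hε : 0 < ε)
    (htyp : ∀ x ∈ F, ∀ V ∈ 𝒲, 1 - ε / 2 ≤ ∑ y ∈ decodingRegion T x, ∏ i, V (x i) (y i))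
    (M : ℕ) (hM : (M : ℝ) * (4 * (empChannels X Y n).card ^ 2) <
      ε * Real.exp T + 4 * (empChannels X Y n).card ^ 2) :
    ∃ (c : Fin M → Fin n → X) (D : Fin M → Finset (Fin n → Y)),
      (∀ m, c m ∈ F) ∧ (∀ m, D m ⊆ decodingRegion T (c m)) ∧
      (∀ m m', m ≠ m' → Disjoint (D m) (D m')) ∧
      ∀ V ∈ 𝒲, ∀ m, ∑ y ∈ (D m)ᶜ, ∏ i, V (c m i) (y i) ≤ ε := by
  induction M with
  | zero => exact ⟨Fin.elim0, Fin.elim0, fun m => m.elim0, fun m => m.elim0, fun m => m.elim0,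
      fun V _ m => m.elim0⟩
  | succ M ih =>
    set K : ℝ := (((empChannels X Y n).card : ℕ) : ℝ) with hK
    have hK0 : 0 ≤ K := Nat.cast_nonneg _
    push_cast at hM
    have hM' : (M : ℝ) * (4 * K ^ 2) < ε * Real.exp T := by linarith
    obtain ⟨c, D, hcF, hDA, hdisj, herr⟩ := ih (by nlinarith [sq_nonneg K])
    set B : Finset (Fin n → Y) := Finset.univ.biUnion D with hB
    have hBdisj : ∀ (x : Fin n → X) m, Disjoint (decodingRegion T x \ B) (D m) := fun x m =>
      Finset.sdiff_disjoint.mono_right (Finset.subset_biUnion_of_mem D (Finset.mem_univ m))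
    obtain ⟨x, hxF, hx⟩ : ∃ x ∈ F, ∀ V ∈ 𝒲,
        1 - ε ≤ ∑ y ∈ decodingRegion T x \ B, ∏ i, V (x i) (y i) := by
      by_contra! hcon
      have covered : ∀ x ∈ F, ε / 2 ≤ ∑ y ∈ B, condMaxLik x y := by
        intro x hx
        obtain ⟨V, hV, hlt⟩ := hcon x hx
        have h := htyp x hx V hV
        rw [← Finset.sum_inter_add_sum_sdiff _ B] at h
        have hle : ∑ y ∈ decodingRegion T x ∩ B, ∏ i, V (x i) (y i) ≤
            ∑ y ∈ B, condMaxLik x y :=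
          (Finset.sum_le_sum_of_subset_of_nonneg Finset.inter_subset_right fun y _ _ =>
            Finset.prod_nonneg fun i _ => (h𝒲 V hV).1 _ _).trans
            (Finset.sum_le_sum fun y _ => prod_le_condMaxLik (h𝒲 V hV).isSubchannel x y)
        linarith
      have hPn : ∀ x : Fin n → X, 0 ≤ ∏ i, P (x i) := fun x =>
        Finset.prod_nonneg fun i _ => hP.1 _
      have lower : ε / 4 ≤ ∑ x : Fin n → X, (∏ i, P (x i)) * ∑ y ∈ B, condMaxLik x y := by
        calc ε / 4 = 1 / 2 * (ε / 2) := by ring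
          _ ≤ (∑ x ∈ F, ∏ i, P (x i)) * (ε / 2) := by gcongr
          _ = ∑ x ∈ F, (∏ i, P (x i)) * (ε / 2) := Finset.sum_mul _ _ _
          _ ≤ ∑ x ∈ F, (∏ i, P (x i)) * ∑ y ∈ B, condMaxLik x y :=
              Finset.sum_le_sum fun x hx => mul_le_mul_of_nonneg_left (covered x hx) (hPn x)
          _ ≤ _ := Finset.sum_le_sum_of_subset_of_nonneg (Finset.subset_univ _) fun x _ _ =>
              mul_nonneg (hPn x) (Finset.sum_nonneg fun y _ =>
                Finset.prod_nonneg fun i _ => (isSubchannel_empCond x y).1 _ _)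
      have upper : ∑ x : Fin n → X, (∏ i, P (x i)) * ∑ y ∈ B, condMaxLik x y ≤
          K * (M * (Real.exp (-T) * K)) := by
        simp_rw [Finset.mul_sum]
        rw [Finset.sum_comm]
        refine (Finset.sum_le_sum fun y _ => sum_mul_condMaxLik_le hP y).trans ?_
        rw [← Finset.mul_sum]
        refine mul_le_mul_of_nonneg_left ?_ hK0
        rw [hB, Finset.sum_biUnion fun m _ m' _ h => hdisj m m' h]
        refine (Finset.sum_le_sum fun m _ =>
          (Finset.sum_le_sum_of_subset_of_nonneg (hDA m) fun y _ _ => maxLik_nonneg y).trans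
            (sum_decodingRegion_maxLik_le T (c m))).trans ?_
        simp [hK]
      have h := mul_le_mul_of_nonneg_right (lower.trans upper) (Real.exp_pos T).le
      have e : K * (M * (Real.exp (-T) * K)) * Real.exp T = M * K ^ 2 := by
        calc _ = M * K ^ 2 * (Real.exp (-T) * Real.exp T) := by ring
          _ = _ := by rw [← Real.exp_add]; simp
      rw [e] at h
      linarith
    refine ⟨Fin.snoc (α := fun _ => Fin n → X) c x,
      Fin.snoc (α := fun _ => Finset (Fin n → Y)) D (decodingRegion T x \ B), ?_, ?_, ?_, ?_⟩
    · intro m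
      induction m using Fin.lastCases <;> simp [hxF, hcF]
    · intro m
      induction m using Fin.lastCases <;> simp [hDA]
    · intro m m' hmm'
      induction m using Fin.lastCases with
      | last =>
        induction m' using Fin.lastCases with
        | last => exact absurd rfl hmm'
        | cast m' => simpa using hBdisj x m'
      | cast m =>
        induction m' using Fin.lastCases with
        | last => simpa using (hBdisj x m).symm
        | cast m' => simpa using hdisj m m' fun h => hmm' (by rw [h])
    · intro V hV m
      induction m using Fin.lastCases with
      | last =>
        have h := Finset.sum_add_sum_compl (decodingRegion T x \ B)
          fun y => ∏ i, V (x i) (y i)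
        rw [(h𝒲 V hV).sum_prod] at h
        simp only [Fin.snoc_last]
        linarith [hx V hV]
      | cast m => simpa using herr V hV m

end Decoding

section Typicality

variable {X Y : Type} [Fintype X] [DecidableEq X] [Fintype Y] [DecidableEq Y]

theorem maxLik_eq_exp {n : ℕ} (hn : 0 < n) (y : Fin n → Y) :
    maxLik y = Real.exp (-(n * ∑ b, Real.negMulLog (emp n y b))) := by
  have h := sum_comp_eq_emp hn y fun b => Real.log (emp n y b)
  have e : -(n * ∑ b, Real.negMulLog (emp n y b)) = ∑ i, Real.log (emp n y (y i)) := by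
    rw [h, ← mul_neg, ← Finset.sum_neg_distrib]
    simp_rw [Real.negMulLog, neg_mul, neg_neg]
  rw [e, Real.exp_sum, maxLik]
  exact Finset.prod_congr rfl fun i _ => (Real.exp_log (emp_pos hn y i)).symm

/-- Uniformly over all channels and input words, the output lands in the decoding region with high
probability as long as the threshold is below the mutual information. -/
theorem exists_one_sub_le_sum_decodingRegion (X Y : Type) [Fintype X] [DecidableEq X] [Fintype Y]
    [DecidableEq Y] {δ η : ℝ} (hδ : 0 < δ) (hη : 0 < η) :
    ∃ N : ℕ, 0 < N ∧ ∀ n : ℕ, N ≤ n → ∀ V : X → Y → ℝ, IsChannel V → ∀ (x : Fin n → X) (T : ℝ),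
      T ≤ n * (mutInfo (emp n x) V - δ) →
      1 - η ≤ ∑ y ∈ decodingRegion T x, ∏ i, V (x i) (y i) := by
  obtain ⟨r, hr, hmod⟩ := exists_entropy_modulus Y (half_pos hδ)
  obtain ⟨N, hN, hlarge⟩ := exists_div_le
    (4 * Fintype.card Y / (δ / 2) ^ 2 + Fintype.card Y / r ^ 2) hη
  refine ⟨N, hN, fun n hn V hV x T hT => ?_⟩
  have hn0 : 0 < n := hN.trans_le hn
  have hn' : (0 : ℝ) < n := by positivity
  have hP := isPM_emp hn0 x
  have hQ := hP.output hV
  set h : ℝ := ∑ a, emp n x a * ∑ b, Real.negMulLog (V a b)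
  have mean : ∑ i, ∑ b, V (x i) b * Real.log (V (x i) b) = -(n * h) := by
    rw [sum_comp_eq_emp hn0 x fun a => ∑ b, V a b * Real.log (V a b), ← mul_neg,
      ← Finset.sum_neg_distrib]
    simp_rw [← mul_neg, ← Finset.sum_neg_distrib, Real.negMulLog, neg_mul, neg_neg]
  have likelihoods := chebyshev_prod (fun i b => hV.1 (x i) b) (fun i => hV.2 (x i))
    (fun i b => Real.log (V (x i) b)) (s := 4 * Fintype.card Y * n) (t := n * (δ / 2))
    (by
      refine (Finset.sum_le_sum fun i _ => Finset.sum_le_sum fun b _ =>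
        mul_log_sq_le (hV.1 (x i) b) (hV.le_one (x i) b)).trans (le_of_eq ?_)
      simp only [Finset.sum_const, Finset.card_univ, nsmul_eq_mul, Fintype.card_fin]
      ring) (by positivity)
  have types := emp_concentration hn0 (fun i b => hV.1 (x i) b) (fun i => hV.2 (x i)) hr
  rw [mean] at likelihoods
  set bad₁ : Finset (Fin n → Y) := Finset.univ.filter fun y =>
    n * (δ / 2) ≤ |∑ i, Real.log (V (x i) (y i)) - -(n * h)|
  set bad₂ : Finset (Fin n → Y) := Finset.univ.filter fun y =>
    ∃ b, r ≤ |emp n y b - (∑ i, V (x i) b) / n|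
  have good : ∀ y, y ∉ bad₁ → y ∉ bad₂ → y ∉ decodingRegion T x →
      ∏ i, V (x i) (y i) = 0 := by
    intro y hy₁ hy₂ hy
    by_contra hne
    have hVpos : ∀ i, 0 < V (x i) (y i) := fun i =>
      (hV.1 _ _).lt_of_ne' (Finset.prod_ne_zero_iff.1 hne i (Finset.mem_univ i))
    refine hy (Finset.mem_filter.2 ⟨Finset.mem_univ _,
      le_trans ?_ (prod_le_condMaxLik hV.isSubchannel x y)⟩)
    have hprod : ∏ i, V (x i) (y i) = Real.exp (∑ i, Real.log (V (x i) (y i))) := by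
      rw [Real.exp_sum]
      exact Finset.prod_congr rfl fun i _ => (Real.exp_log (hVpos i)).symm
    rw [hprod, maxLik_eq_exp hn0, ← Real.exp_add, Real.exp_le_exp]
    have h₁ : |∑ i, Real.log (V (x i) (y i)) - -(n * h)| < n * (δ / 2) :=
      not_le.1 fun hle => hy₁ (Finset.mem_filter.2 ⟨Finset.mem_univ _, hle⟩)
    have h₂ := hmod _ _ (isPM_emp hn0 y) hQ fun b => by
      have hb : |emp n y b - (∑ i, V (x i) b) / n| < r := not_le.1 fun hle =>
        hy₂ (Finset.mem_filter.2 ⟨Finset.mem_univ _, b, hle⟩)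
      rwa [sum_comp_eq_emp hn0 x fun a => V a b, mul_div_cancel_left₀ _ hn'.ne'] at hb
    rw [mutInfo_eq hP hV] at hT
    have h₃ := mul_le_mul_of_nonneg_left (abs_le.1 h₂).1 hn'.le
    linarith [(abs_lt.1 h₁).1]
  have nonneg : ∀ y : Fin n → Y, 0 ≤ ∏ i, V (x i) (y i) := fun y =>
    Finset.prod_nonneg fun i _ => hV.1 _ _
  have cover : ∑ y : Fin n → Y, ∏ i, V (x i) (y i) ≤
      ∑ y ∈ decodingRegion T x, ∏ i, V (x i) (y i) +
        (∑ y ∈ bad₁, ∏ i, V (x i) (y i) + ∑ y ∈ bad₂, ∏ i, V (x i) (y i)) := by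
    have union_le : ∀ A B : Finset (Fin n → Y), ∑ y ∈ A ∪ B, ∏ i, V (x i) (y i) ≤
        ∑ y ∈ A, ∏ i, V (x i) (y i) + ∑ y ∈ B, ∏ i, V (x i) (y i) := fun A B => by
      rw [← Finset.sum_union_inter]
      exact le_add_of_nonneg_right (Finset.sum_nonneg fun y _ => nonneg y)
    refine le_trans (le_of_eq ?_)
      ((union_le _ _).trans (add_le_add_right (union_le bad₁ bad₂) _))
    refine (Finset.sum_subset (Finset.subset_univ _) fun y _ hy => ?_).symm
    simp only [Finset.mem_union, not_or] at hy
    exact good y hy.2.1 hy.2.2 hy.1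
  rw [hV.sum_prod] at cover
  have e : 4 * (Fintype.card Y : ℝ) * n / (n * (δ / 2)) ^ 2 + Fintype.card Y / (n * r ^ 2) =
      (4 * Fintype.card Y / (δ / 2) ^ 2 + Fintype.card Y / r ^ 2) / n := by
    field_simp
  linarith [hlarge n hn]

theorem exists_half_le_sum_typical {P : X → ℝ} (hP : IsPM P) {r : ℝ} (hr : 0 < r) :
    ∃ N : ℕ, 0 < N ∧ ∀ n : ℕ, N ≤ n →
      1 / 2 ≤ ∑ x : Fin n → X with (∀ a, |emp n x a - P a| < r) ∧ ∏ i, P (x i) ≠ 0,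
        ∏ i, P (x i) := by
  obtain ⟨N, hN, hlarge⟩ := exists_div_le (Fintype.card X / r ^ 2) one_half_pos
  refine ⟨N, hN, fun n hn => ?_⟩
  have hn0 : 0 < n := hN.trans_le hn
  have hn' : (n : ℝ) ≠ 0 := by positivity
  have conc := emp_concentration hn0 (fun _ : Fin n => hP.1) (fun _ => hP.2) hr
  simp only [Finset.sum_const, Finset.card_univ, Fintype.card_fin, nsmul_eq_mul,
    mul_div_cancel_left₀ _ hn'] at conc
  have total := sum_prod_eq_prod_sum fun (_ : Fin n) a => P a
  simp only [hP.2, Finset.prod_const_one] at total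
  rw [← Finset.sum_filter_add_sum_filter_not Finset.univ fun x : Fin n → X =>
    ∃ a, r ≤ |emp n x a - P a|] at total
  have e : (Fintype.card X : ℝ) / (n * r ^ 2) = Fintype.card X / r ^ 2 / n := by field_simp
  have h := hlarge n hn
  rw [← Finset.filter_filter, Finset.sum_filter_ne_zero]
  simp only [not_exists, not_le] at total
  linarith

end Typicality

section Achievability

variable {X Y : Type} [Fintype X] [DecidableEq X] [Fintype Y] [DecidableEq Y]

/-- Any input law meeting the budget can be perturbed so that typical words meet it exactly. -/
theorem exists_input_law [Nonempty X] {Γ : X → ℝ} {B : ℝ}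
    (hΓ : ∀ x, 0 ≤ Γ x) (hB : Finset.univ.inf' Finset.univ_nonempty Γ ≤ B) {P : X → ℝ}
    (hP : IsPM P) (hcost : ∑ a, Γ a * P a ≤ B) {r : ℝ} (hr : 0 < r) :
    ∃ P' : X → ℝ, IsPM P' ∧ (∀ a, |P a - P' a| < r) ∧ ∃ r' > 0, ∀ n : ℕ, 0 < n →
      ∀ x : Fin n → X, (∀ a, |emp n x a - P' a| < r') → ∏ i, P' (x i) ≠ 0 →
        ∑ a, Γ a * emp n x a ≤ B := by
  obtain ⟨a₀, -, ha₀⟩ := Finset.exists_mem_eq_inf' Finset.univ_nonempty Γ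
  have hmin : ∀ a, Γ a₀ ≤ Γ a := fun a => ha₀ ▸ Finset.inf'_le Γ (Finset.mem_univ a)
  rw [ha₀] at hB
  set t : ℝ := min (r / 2) (1 / 2)
  have ht0 : 0 < t := by positivity
  have ht1 : t ≤ 1 / 2 := min_le_right _ _
  have htr : t < r := (min_le_left _ _).trans_lt (by linarith)
  let P' : X → ℝ := fun a => (1 - t) * P a + t * if a = a₀ then 1 else 0
  have hP' : IsPM P' := by
    refine ⟨fun a => ?_, ?_⟩
    · have := hP.1 a
      have h1 : 0 ≤ 1 - t := by linarith
      positivity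
    · simp [P', Finset.sum_add_distrib, ← Finset.mul_sum, hP.2]
  have hcost' : ∑ a, Γ a * P' a = (1 - t) * ∑ a, Γ a * P a + t * Γ a₀ := by
    simp only [P', mul_add, Finset.sum_add_distrib, Finset.mul_sum]
    congr 1
    · exact Finset.sum_congr rfl fun a _ => by ring
    · simp [mul_comm]
  refine ⟨P', hP', fun a => ?_, ?_⟩
  · have e : P a - P' a = t * (P a - if a = a₀ then 1 else 0) := by
      simp only [P']
      ring
    have h1 : |P a - if a = a₀ then 1 else 0| ≤ 1 := by
      rw [abs_le]
      split_ifs <;> constructor <;> linarith [hP.1 a, hP.le_one a]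
    rw [e, abs_mul, abs_of_pos ht0]
    nlinarith
  rcases lt_or_ge (∑ a, Γ a * P' a) B with hlt | hge
  · have hΓsum : 0 ≤ ∑ a, Γ a := Finset.sum_nonneg fun a _ => hΓ a
    refine ⟨(B - ∑ a, Γ a * P' a) / (∑ a, Γ a + 1),
      div_pos (by linarith) (by linarith), fun n _ x hx _ => ?_⟩
    set r' : ℝ := (B - ∑ a, Γ a * P' a) / (∑ a, Γ a + 1) with hr'
    have hr'0 : 0 < r' := div_pos (by linarith) (by linarith)
    have hr'' : r' * (∑ a, Γ a + 1) = B - ∑ a, Γ a * P' a :=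
      div_mul_cancel₀ _ (by linarith)
    calc ∑ a, Γ a * emp n x a ≤ ∑ a, (Γ a * P' a + Γ a * r') :=
          Finset.sum_le_sum fun a _ => by
            rw [← mul_add]
            exact mul_le_mul_of_nonneg_left (by linarith [(abs_lt.1 (hx a)).2]) (hΓ a)
      _ = ∑ a, Γ a * P' a + (∑ a, Γ a) * r' := by
          rw [Finset.sum_add_distrib, Finset.sum_mul]
      _ ≤ B := by linarith
  · refine ⟨1, one_pos, fun n hn x _ hx => ?_⟩
    have hn' : (0 : ℝ) < n := by positivity
    have hle : ∑ a, Γ a * P a ≤ Γ a₀ := by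
      rw [hcost'] at hge
      have : t * ∑ a, Γ a * P a ≤ t * Γ a₀ := by linarith
      exact le_of_mul_le_mul_left this ht0
    have hzero : ∑ a, (Γ a - Γ a₀) * P a = 0 := by
      refine le_antisymm ?_ (Finset.sum_nonneg fun a _ =>
        mul_nonneg (sub_nonneg.2 (hmin a)) (hP.1 a))
      simp_rw [sub_mul, Finset.sum_sub_distrib, ← Finset.mul_sum, hP.2]
      linarith
    have hsupp : ∀ a, P' a ≠ 0 → Γ a = Γ a₀ := by
      intro a ha
      by_cases haa : a = a₀
      · rw [haa]
      have h := (Finset.sum_eq_zero_iff_of_nonneg fun a _ =>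
        mul_nonneg (sub_nonneg.2 (hmin a)) (hP.1 a)).1 hzero a (Finset.mem_univ a)
      have hPa : P a ≠ 0 := fun h0 => ha (by simp [P', h0, haa])
      exact sub_eq_zero.1 ((mul_eq_zero.1 h).resolve_right hPa)
    have h := sum_comp_eq_emp hn x Γ
    rw [Finset.sum_congr rfl fun i _ =>
      hsupp (x i) (Finset.prod_ne_zero_iff.1 hx i (Finset.mem_univ i))] at h
    simp only [Finset.sum_const, Finset.card_univ, Fintype.card_fin, nsmul_eq_mul] at h
    simp_rw [mul_comm (Γ _)]
    rw [← mul_left_cancel₀ hn'.ne' h]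
    exact hB

/-- Codes for a compound channel: every rate below the worst mutual information is attained, at a
block length that does not depend on the family of channels. -/
theorem exists_compound_code [Nonempty X] [Nonempty Y] {Γ : X → ℝ} {B : ℝ}
    (hΓ : ∀ x, 0 ≤ Γ x) (hB : Finset.univ.inf' Finset.univ_nonempty Γ ≤ B) {P : X → ℝ}
    (hP : IsPM P) (hcost : ∑ a, Γ a * P a ≤ B) {ε δ : ℝ} (hε : 0 < ε) (hδ : 0 < δ) :
    ∃ N : ℕ, ∀ n : ℕ, N ≤ n → ∀ (𝒲 : Set (X → Y → ℝ)) (s : ℝ),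
      (∀ V ∈ 𝒲, IsChannel V) → (∀ V ∈ 𝒲, s ≤ mutInfo P V) →
      ∃ (M : ℕ) (c : Fin M → Fin n → X) (D : Fin M → Finset (Fin n → Y)), 0 < M ∧
        (∀ m, ∑ a, Γ a * emp n (c m) a ≤ B) ∧
        (∀ m m', m ≠ m' → Disjoint (D m) (D m')) ∧
        (∀ V ∈ 𝒲, ∀ m, ∑ y ∈ (D m)ᶜ, ∏ i, V (c m i) (y i) ≤ ε) ∧
        s - δ ≤ (n : ℝ)⁻¹ * Real.log M := by
  have hδ3 : 0 < δ / 3 := by linarith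
  obtain ⟨r, hr, hmod⟩ := exists_mutInfo_modulus X Y hδ3
  obtain ⟨P', hP', hPP', r', hr', hbudget⟩ := exists_input_law hΓ hB hP hcost (half_pos hr)
  obtain ⟨N₁, hN₁, h₁⟩ := exists_half_le_sum_typical hP' (lt_min hr' (half_pos hr))
  obtain ⟨N₂, hN₂, h₂⟩ := exists_one_sub_le_sum_decodingRegion X Y hδ3 (half_pos hε)
  obtain ⟨N₃, h₃⟩ := exists_mul_pow_le_exp (4 / ε) (Fintype.card X * Fintype.card Y * 2) hδ3
  refine ⟨max N₁ (max N₂ N₃), fun n hn 𝒲 s h𝒲 hs => ?_⟩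
  simp only [max_le_iff] at hn
  have hn0 : 0 < n := hN₁.trans_le hn.1
  have hn' : (0 : ℝ) < n := by positivity
  set T : ℝ := n * (s - δ / 3 - δ / 3) with hT
  set K : ℝ := 4 * (((empChannels X Y n).card : ℕ) : ℝ) ^ 2 with hK
  have hFtyp := h₁ n hn.1
  set F : Finset (Fin n → X) := Finset.univ.filter fun x =>
    (∀ a, |emp n x a - P' a| < min r' (r / 2)) ∧ ∏ i, P' (x i) ≠ 0 with hF
  have hFmem : ∀ x ∈ F, (∀ a, |emp n x a - P' a| < min r' (r / 2)) ∧ ∏ i, P' (x i) ≠ 0 :=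
    fun x hx => (Finset.mem_filter.1 hx).2
  have hKexp : K ≤ ε * Real.exp (n * (δ / 3)) := by
    have hcard : ((empChannels X Y n).card : ℝ) ≤
        ((n : ℝ) + 1) ^ (Fintype.card X * Fintype.card Y) := by
      exact_mod_cast card_empChannels_le X Y n
    have h := h₃ n hn.2.2
    rw [div_mul_eq_mul_div, div_le_iff₀ hε, pow_mul] at h
    calc K ≤ 4 * (((n : ℝ) + 1) ^ (Fintype.card X * Fintype.card Y)) ^ 2 := by
          rw [hK]
          gcongr
      _ ≤ _ := by linarith
  have hKpos : 0 < K := by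
    have hne : (empChannels X Y n).Nonempty := Finset.univ_nonempty.image _
    have := hne.card_pos
    positivity
  set M : ℕ := ⌈ε * Real.exp T / K⌉₊ with hM
  have hMpos : 0 < M := Nat.ceil_pos.2 (by positivity)
  have hMlt : (M : ℝ) * K < ε * Real.exp T + K := by
    have h := Nat.ceil_lt_add_one (a := ε * Real.exp T / K) (by positivity)
    rw [← hM, ← sub_lt_iff_lt_add, lt_div_iff₀ hKpos] at h
    linarith
  obtain ⟨c, D, hc, -, hdisj, herr⟩ := exists_code_of_card_lt h𝒲 hP' hFtyp hε (T := T)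
    (fun x hx V hV => h₂ n hn.2.1 V (h𝒲 V hV) x T (by
      rw [hT]
      refine mul_le_mul_of_nonneg_left ?_ hn'.le
      have hclose : ∀ a, |P a - emp n x a| < r := fun a => by
        have ha := ((hFmem x hx).1 a).trans_le (min_le_right _ _)
        rw [abs_sub_comm] at ha
        linarith [abs_sub_le (P a) (P' a) (emp n x a), hPP' a]
      linarith [hmod P (emp n x) hP (isPM_emp hn0 x) hclose V (h𝒲 V hV), hs V hV])) M hMlt
  refine ⟨M, c, D, hMpos, fun m => ?_, hdisj, herr, ?_⟩
  · exact hbudget n hn0 (c m) (fun a => ((hFmem _ (hc m)).1 a).trans_le (min_le_left _ _))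
      (hFmem _ (hc m)).2
  · rw [le_inv_mul_iff₀ hn', Real.le_log_iff_exp_le (by positivity)]
    calc Real.exp (n * (s - δ)) = Real.exp T / Real.exp (n * (δ / 3)) := by
          rw [← Real.exp_sub, hT]
          ring_nf
      _ = ε * Real.exp T / (ε * Real.exp (n * (δ / 3))) := by
          rw [mul_div_mul_left _ _ hε.ne']
      _ ≤ ε * Real.exp T / K := by gcongr
      _ ≤ M := Nat.le_ceil _

end Achievability

section OutageCapacity

variable {X Y Θ : Type} [Fintype X] [Fintype Y] [MeasurableSpace Θ]
  {μ : MeasureTheory.Measure Θ} {W : Θ → X → Y → ℝ} {γ : ℝ}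

theorem nonempty_of_one_sub_le (hγ : γ < 1) {Λ : Set Θ} (h : ENNReal.ofReal (1 - γ) ≤ μ Λ) :
    Λ.Nonempty := by
  rw [Set.nonempty_iff_ne_empty]
  rintro rfl
  rw [MeasureTheory.measure_empty, nonpos_iff_eq_zero, ENNReal.ofReal_eq_zero] at h
  linarith

omit [MeasurableSpace Θ] in
theorem bddBelow_image_mutInfo (hW : ∀ θ, IsChannel (W θ)) {P : X → ℝ} (hP : IsPM P)
    (Λ : Set Θ) : BddBelow ((fun θ => mutInfo P (W θ)) '' Λ) :=
  ⟨0, by rintro _ ⟨θ, -, rfl⟩; exact mutInfo_nonneg hP (hW θ)⟩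

theorem sInf_image_mutInfo_le_card (hW : ∀ θ, IsChannel (W θ)) {P : X → ℝ} (hP : IsPM P)
    (hγ : γ < 1) {Λ : Set Θ} (h : ENNReal.ofReal (1 - γ) ≤ μ Λ) :
    sInf ((fun θ => mutInfo P (W θ)) '' Λ) ≤ Fintype.card Y := by
  obtain ⟨θ, hθ⟩ := nonempty_of_one_sub_le hγ h
  exact (csInf_le (bddBelow_image_mutInfo hW hP Λ) (Set.mem_image_of_mem _ hθ)).trans
    (mutInfo_le hP (hW θ))

theorem ratesFormula_nonneg (hW : ∀ θ, IsChannel (W θ)) {P : X → ℝ} (hP : IsPM P) :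
    0 ≤ ratesFormula μ W γ P := by
  refine Real.sSup_nonneg ?_
  rintro _ ⟨Λ, -, -, rfl⟩
  refine Real.sInf_nonneg ?_
  rintro _ ⟨θ, -, rfl⟩
  exact mutInfo_nonneg hP (hW θ)

theorem ratesFormula_le_card (hW : ∀ θ, IsChannel (W θ)) {P : X → ℝ} (hP : IsPM P)
    (hγ : γ < 1) : ratesFormula μ W γ P ≤ Fintype.card Y := by
  refine Real.sSup_le ?_ (Nat.cast_nonneg _)
  rintro _ ⟨Λ, -, hΛ, rfl⟩
  exact sInf_image_mutInfo_le_card hW hP hγ hΛ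

theorem sInf_image_mutInfo_le_ratesFormula (hW : ∀ θ, IsChannel (W θ)) {P : X → ℝ}
    (hP : IsPM P) (hγ : γ < 1) {Λ : Set Θ} (hΛm : MeasurableSet Λ)
    (h : ENNReal.ofReal (1 - γ) ≤ μ Λ) :
    sInf ((fun θ => mutInfo P (W θ)) '' Λ) ≤ ratesFormula μ W γ P := by
  refine le_csSup ⟨(Fintype.card Y : ℝ), ?_⟩ ⟨Λ, hΛm, h, rfl⟩
  rintro _ ⟨Λ', -, hΛ', rfl⟩
  exact sInf_image_mutInfo_le_card hW hP hγ hΛ'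

theorem exists_isPM_cost_le [Nonempty X] {Γ : X → ℝ} {B : ℝ}
    (hB : Finset.univ.inf' Finset.univ_nonempty Γ ≤ B) :
    ∃ P : X → ℝ, IsPM P ∧ ∑ a, Γ a * P a ≤ B := by
  classical
  obtain ⟨a₀, -, ha₀⟩ := Finset.exists_mem_eq_inf' (Finset.univ_nonempty (α := X)) Γ
  refine ⟨fun a => if a = a₀ then 1 else 0, ⟨fun a => by positivity, by simp⟩, ?_⟩
  simpa [← ha₀] using hB

variable [DecidableEq X] [DecidableEq Y]

theorem measurableSet_lambdaSet (hW : ∀ x y, Measurable fun θ => W θ x y) {n M : ℕ}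
    (c : Fin M → Fin n → X) (D : Fin M → Finset (Fin n → Y)) (ε : ℝ) :
    MeasurableSet (lambdaSet W c D ε) := by
  rw [lambdaSet, Set.ofPred_forall]
  refine MeasurableSet.iInter fun m => measurableSet_le ?_ measurable_const
  exact Finset.measurable_fun_sum _ fun y _ =>
    Finset.measurable_fun_prod _ fun i _ => hW (c m i) (y i)

theorem exists_sub_le_ratesFormula (hW : ∀ θ, IsChannel (W θ))
    (hWmeas : ∀ x y, Measurable fun θ => W θ x y) (hγ1 : γ < 1) {Γ : X → ℝ} {B ε R δ : ℝ}
    (hε : ε < 1) (hR : Achievable μ W Γ B γ ε R) (hδ : 0 < δ) :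
    ∃ P : X → ℝ, IsPM P ∧ ∑ a, Γ a * P a ≤ B ∧ R - δ ≤ ratesFormula μ W γ P := by
  obtain ⟨N₁, h₁⟩ := hR (δ / 2) (half_pos hδ)
  obtain ⟨N₂, hN₂, h₂⟩ := exists_codeword_rate_le X Y hε (half_pos hδ)
  obtain ⟨M, c, D, hM, hc, hD, hΛ, hrate⟩ := h₁ _ (le_max_left N₁ N₂)
  obtain ⟨m₀, hm₀⟩ := h₂ _ (le_max_right N₁ N₂) M c D hM hD
  have hP := isPM_emp (lt_max_of_lt_right hN₂) (c m₀)
  refine ⟨_, hP, hc m₀, le_trans ?_ (sInf_image_mutInfo_le_ratesFormula hW hP hγ1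
    (measurableSet_lambdaSet hWmeas c D ε) hΛ)⟩
  refine le_csInf ((nonempty_of_one_sub_le hγ1 hΛ).image _) ?_
  rintro _ ⟨θ, hθ, rfl⟩
  have := hm₀ (W θ) (hW θ) hθ
  dsimp only
  linarith

variable [MeasureTheory.IsProbabilityMeasure μ]

theorem achievable_ratesFormula [Nonempty X] [Nonempty Y] (hW : ∀ θ, IsChannel (W θ))
    (hγ0 : 0 < γ) {Γ : X → ℝ} (hΓ : ∀ x, 0 ≤ Γ x) {B : ℝ}
    (hB : Finset.univ.inf' Finset.univ_nonempty Γ ≤ B) {P : X → ℝ} (hP : IsPM P)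
    (hcost : ∑ a, Γ a * P a ≤ B) {ε : ℝ} (hε : 0 < ε) :
    Achievable μ W Γ B γ ε (ratesFormula μ W γ P) := by
  intro δ hδ
  obtain ⟨_, ⟨Λ, -, hΛ, rfl⟩, hlt⟩ := exists_lt_of_lt_csSup
    (s := {r : ℝ | ∃ Λ : Set Θ, MeasurableSet Λ ∧ ENNReal.ofReal (1 - γ) ≤ μ Λ ∧
      r = sInf ((fun θ => mutInfo P (W θ)) '' Λ)})
    ⟨_, Set.univ, MeasurableSet.univ, by
      rw [MeasureTheory.measure_univ, ENNReal.ofReal_le_one]; linarith, rfl⟩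
    (sub_lt_self (ratesFormula μ W γ P) (half_pos hδ))
  obtain ⟨N, hN⟩ := exists_compound_code (Y := Y) hΓ hB hP hcost hε (half_pos hδ)
  refine ⟨N, fun n hn => ?_⟩
  obtain ⟨M, c, D, hM, hc, hD, herr, hrate⟩ := hN n hn (W '' Λ)
    (sInf ((fun θ => mutInfo P (W θ)) '' Λ))
    (by rintro _ ⟨θ, -, rfl⟩; exact hW θ)
    (by
      rintro _ ⟨θ, hθ, rfl⟩
      exact csInf_le (bddBelow_image_mutInfo hW hP Λ) (Set.mem_image_of_mem _ hθ))
  exact ⟨M, c, D, hM, hc, hD, hΛ.trans (MeasureTheory.measure_mono fun θ hθ m =>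
    herr _ (Set.mem_image_of_mem W hθ) m), by linarith⟩

end OutageCapacity

theorem outage_capacity_strong_converse
    (X Y Θ : Type) [Fintype X] [Fintype Y] [Nonempty X] [Nonempty Y]
    [DecidableEq X] [DecidableEq Y] [MeasurableSpace Θ]
    (μ : MeasureTheory.Measure Θ) [MeasureTheory.IsProbabilityMeasure μ]
    (W : Θ → X → Y → ℝ) (hW : ∀ θ, IsChannel (W θ))
    (hWmeas : ∀ x y, Measurable fun θ => W θ x y)
    (γ : ℝ) (hγ0 : 0 < γ) (hγ1 : γ < 1)
    (Γ : X → ℝ) (hΓ : ∀ x, 0 ≤ Γ x)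
    (Pbudget : ℝ) (hP : Finset.univ.inf' Finset.univ_nonempty Γ ≤ Pbudget) :
    ∀ ε : ℝ, 0 < ε → ε < 1 →
      sSup {R : ℝ | 0 ≤ R ∧ Achievable μ W Γ Pbudget γ ε R} =
        sSup {v : ℝ | ∃ P : X → ℝ, IsPM P ∧ (∑ a, Γ a * P a) ≤ Pbudget ∧
          v = ratesFormula μ W γ P} := by
  intro ε hε0 hε1
  have bdd : BddAbove {v : ℝ | ∃ P : X → ℝ, IsPM P ∧ (∑ a, Γ a * P a) ≤ Pbudget ∧
      v = ratesFormula μ W γ P} :=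
    ⟨Fintype.card Y, by rintro _ ⟨P, hPM, -, rfl⟩; exact ratesFormula_le_card hW hPM hγ1⟩
  have achievable_of_cost_le : ∀ P : X → ℝ, IsPM P → (∑ a, Γ a * P a) ≤ Pbudget →
      ratesFormula μ W γ P ∈ {R : ℝ | 0 ≤ R ∧ Achievable μ W Γ Pbudget γ ε R} :=
    fun P hPM hcost => ⟨ratesFormula_nonneg hW hPM,
      achievable_ratesFormula hW hγ0 hΓ hP hPM hcost hε0⟩
  have le_of_achievable : ∀ R ∈ {R : ℝ | 0 ≤ R ∧ Achievable μ W Γ Pbudget γ ε R},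
      R ≤ sSup {v : ℝ | ∃ P : X → ℝ, IsPM P ∧ (∑ a, Γ a * P a) ≤ Pbudget ∧
        v = ratesFormula μ W γ P} := by
    rintro R ⟨-, hR⟩
    refine le_of_forall_pos_le_add fun δ hδ => ?_
    obtain ⟨P, hPM, hcost, hle⟩ := exists_sub_le_ratesFormula hW hWmeas hγ1 hε1 hR hδ
    exact sub_le_iff_le_add.1 (hle.trans (le_csSup bdd ⟨P, hPM, hcost, rfl⟩))
  obtain ⟨P₀, hP₀, hcost₀⟩ := exists_isPM_cost_le hP
  refine le_antisymm (csSup_le ⟨_, achievable_of_cost_le P₀ hP₀ hcost₀⟩ le_of_achievable)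
    (csSup_le ⟨_, P₀, hP₀, hcost₀, rfl⟩ ?_)
  rintro _ ⟨P, hPM, hcost, rfl⟩
  exact le_csSup ⟨_, le_of_achievable⟩ (achievable_of_cost_le P hPM hcost)
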